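/- arXiv:math/0403246 — 4 statements merged into one kernel-verified Lean document; each statement's English description precedes it below -/
import Mathlib

section
/- Let T, K ∈ End(V)⊗R be such that every matrix entry of T commutes in R with every matrix entry of K, let B ∈ End(V⊗V) be a scalar matrix with B₁₂^{t₁} invertible, and for an ordered label set N = ⟨1,…,k⟩ define T_N := ∏→_{i∈N}( T_i ∏→_{j∈N, j>i} B_{ij} ) and K_N := ∏→_{i∈N}( K_i ∏→_{j∈N, j>i} ((B_{ij}^{t_i})⁻¹)^{t_j} ). Then the undressed quantum trace decouples: Tr_{V^{⊗N}}(K_N^{t_N} T_N) = (Tr_V(K^{t} T))^{#N}, where #N is the cardinality of N. -/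
open Matrix

namespace QT

variable {n : ℕ} {ι : Type*} [Fintype ι] [DecidableEq ι] {α : Type*}
variable {R : Type*} [Ring R] [Algebra ℂ R]

/-- Operators on `V^{⊗ι}`, `V = ℂⁿ`, with entries in `α`. -/
abbrev Tens (ι : Type*) (n : ℕ) (α : Type*) := Matrix (ι → Fin n) (ι → Fin n) α

/-- Two-site matrices, i.e. elements of `End(V ⊗ V)` with entries in `α`. -/
abbrev M2 (n : ℕ) (α : Type*) := Matrix (Fin n × Fin n) (Fin n × Fin n) α

/-- `X_{ij}` : embedding of a two-site matrix at the (distinct) sites `i, j`,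
acting as the identity elsewhere. -/
noncomputable def emb2 [MulZeroOneClass α] (X : M2 n α) (i j : ι) : Tens ι n α :=
  Matrix.of fun f g =>
    if ∀ k, k ≠ i → k ≠ j → f k = g k then X (f i, f j) (g i, g j) else 0

/-- `T_i` : embedding of a one-site matrix at site `i`. -/
noncomputable def emb1 [Zero α] (T : Matrix (Fin n) (Fin n) α) (i : ι) : Tens ι n α :=
  Matrix.of fun f g => if ∀ k, k ≠ i → f k = g k then T (f i) (g i) else 0

/-- Fused matrix `X_{MN} = ∏→_{i∈M} ∏→_{j∈N} X_{ij}` (a bar, i.e. reversal of one of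
the ordered label sets, is obtained by passing `M.reverse` or `N.reverse`). -/
noncomputable def fuse [Semiring α] (X : M2 n α) (M N : List ι) : Tens ι n α :=
  (M.map fun i => (N.map fun j => emb2 X i j).prod).prod

/-- Partial transposition `t_S` in the factors labelled by `S`. -/
noncomputable def ptrans (S : Finset ι) (X : Tens ι n α) : Tens ι n α :=
  Matrix.of fun f g =>
    X (fun k => if k ∈ S then g k else f k) (fun k => if k ∈ S then f k else g k)

/-- Partial transposition `t₁` on a two-site matrix. -/
noncomputable def t1 (X : M2 n α) : M2 n α :=
  Matrix.of fun p q => X (q.1, p.2) (p.1, q.2)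

/-- Partial transposition `t₂` on a two-site matrix. -/
noncomputable def t2 (X : M2 n α) : M2 n α :=
  Matrix.of fun p q => X (p.1, q.2) (q.1, p.2)

/-- `X₂₁ = P X₁₂ P` : permutation of the two factors of a two-site matrix. -/
noncomputable def perm2 (X : M2 n α) : M2 n α :=
  Matrix.of fun p q => X (p.2, p.1) (q.2, q.1)

/-- The permutation (flip) matrix `P` on `V ⊗ V`. -/
noncomputable def PM (n : ℕ) (α : Type*) [Zero α] [One α] : M2 n α :=
  Matrix.of fun p q => if p.1 = q.2 ∧ p.2 = q.1 then 1 else 0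

/-- Index type for `V^{⊗M}`. -/
abbrev idx (n : ℕ) {ι : Type*} [DecidableEq ι] (M : List ι) :=
  {x // x ∈ M.toFinset} → Fin n

/-- Embedding `End(V^{⊗M}) ⊗ R → End(V^{⊗ι}) ⊗ R`, acting as the identity off `M`. -/
noncomputable def embS [Zero α] (M : List ι) (X : Matrix (idx n M) (idx n M) α) :
    Tens ι n α :=
  Matrix.of fun f g =>
    if ∀ k, k ∉ M.toFinset → f k = g k then
      X (fun i => f i.1) (fun i => g i.1) else 0

/-- A pair of disjoint ordered label sets. -/
def OkPair (M N : List ι) : Prop := M.Nodup ∧ N.Nodup ∧ M.Disjoint N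

/-- Fused solution `T_M = ∏→_{i∈M} ( T_i ∏→_{j∈M, j>i} B_{ij} )` of the quadratic
exchange algebra (also used for the dual fusion, with `B` replaced by the
appropriate dual structure matrix). -/
noncomputable def fuseT (B : M2 n ℂ) (T : Matrix (Fin n) (Fin n) R) :
    List ι → Tens ι n R
  | [] => 1
  | i :: M => emb1 T i *
      ((M.map fun j => (emb2 B i j).map (algebraMap ℂ R)).prod) * fuseT B T M

/-- The chain `X̌_{i₁i₂} X̌_{i₂i₃} ⋯ X̌_{i_{m-1}i_m}` along the ordered label set,
where `X̌_{ij} = P_{ij} X_{ij}`. -/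
noncomputable def chainCheck (X : M2 n ℂ) : List ι → Tens ι n ℂ
  | [] => 1
  | [_] => 1
  | i :: j :: M => emb2 (PM n ℂ * X) i j * chainCheck X (j :: M)

/-- The lexicographically ordered product `L_M = ∏_{i<j ∈ M} A_{ij}`. -/
noncomputable def lexA (A : M2 n ℂ) : List ι → Tens ι n ℂ
  | [] => 1
  | i :: M => (M.map fun j => emb2 A i j).prod * lexA A M

/-- DKM-type fused solution
`T̃_M = ∏→_{i∈M} ( (∏→_{j>i} A_{ij}) T_i (∏←_{j>i} B_{ij}) )`. -/
noncomputable def fuseT2 (A B : M2 n ℂ) (T : Matrix (Fin n) (Fin n) R) :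
    List ι → Tens ι n R
  | [] => 1
  | i :: M => ((M.map fun j => emb2 A i j).prod).map (algebraMap ℂ R) * emb1 T i *
      ((M.reverse.map fun j => emb2 B i j).prod).map (algebraMap ℂ R) * fuseT2 A B T M

/-! ### Dynamical setting -/

/-- the space of dynamical parameters `λ ∈ ℂⁿ`. -/
abbrev Lam (n : ℕ) := Fin n → ℂ

/-- standard basis vector `e_a` of `ℂⁿ`. -/
noncomputable def ee {n : ℕ} (a : Fin n) : Lam n := Pi.single a 1

/-- `Σ_{k∈S} e_{f k}` : the dynamical shift read off the indices at the factors in `S`. -/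
noncomputable def shL (S : Finset ι) (f : ι → Fin n) : Lam n := ∑ k ∈ S, ee (f k)

/-- The dynamical shift `X(λ + h_S)` of a matrix-valued function of `λ` (which is
assumed to act as the identity on the factors labelled by `S`). -/
noncomputable def dsh (S : Finset ι) (X : Lam n → Tens ι n α) : Lam n → Tens ι n α :=
  fun lam => Matrix.of fun f g => X (lam + shL S f) f g

/-- Dynamical structure matrices `ℂⁿ → End(V⊗V)`. -/
abbrev DSM (n : ℕ) := Lam n → M2 n ℂ

/-- Fused `A_{MN̄′}` (no dynamical shifts occur in the recursion for `A`). -/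
noncomputable def fuseAd (A : DSM n) (M N : List ι) : Lam n → Tens ι n ℂ :=
  fun lam => fuse (A lam) M N.reverse

/-- Fused `B_{MN′} = B_{1N′} ⋅ B_{M₀N′}(λ+h₁)`. -/
noncomputable def fuseBd (B : DSM n) : List ι → List ι → Lam n → Tens ι n ℂ
  | [], _ => fun _ => 1
  | i :: M, N => fun lam =>
      ((N.map fun j => emb2 (B lam) i j).prod) * dsh {i} (fuseBd B M N) lam

/-- Fused `C_{MN′} = C_{M1′} ⋅ C_{MN′₀}(λ+h_{1′})`. -/
noncomputable def fuseCd (C : DSM n) : List ι → List ι → Lam n → Tens ι n ℂ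
  | _, [] => fun _ => 1
  | M, j :: N => fun lam =>
      ((M.map fun i => emb2 (C lam) i j).prod) * dsh {j} (fuseCd C M N) lam

/-- Fused `D_{iN̄′} = D_{in′}(λ+h_{(1′,n′-1)}) ⋅ D_{i,(N̄′)₀}` (`Nr` is the reversed `N′`). -/
noncomputable def fuseD1 (D : DSM n) (i : ι) : List ι → Lam n → Tens ι n ℂ
  | [] => fun _ => 1
  | j :: Nr => fun lam =>
      dsh Nr.toFinset (fun mu => emb2 (D mu) i j) lam * fuseD1 D i Nr lam

/-- Fused `D_{MN̄′} = D_{1N̄′} ⋅ D_{M₀N̄′}(λ+h₁)`. -/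
noncomputable def fuseDd (D : DSM n) : List ι → List ι → Lam n → Tens ι n ℂ
  | [], _ => fun _ => 1
  | i :: M, N => fun lam => fuseD1 D i N.reverse lam * dsh {i} (fuseDd D M N) lam

/-- zero-weight condition on the first factor: `[B₁₂, h⊗1] = 0` for all diagonal `h`. -/
def WB (B : DSM n) : Prop := ∀ lam (d : Fin n → ℂ),
  B lam * Matrix.diagonal (fun p => d p.1) = Matrix.diagonal (fun p => d p.1) * B lam

/-- zero-weight condition on the second factor: `[C₁₂, 1⊗h] = 0` for all diagonal `h`. -/
def WC (C : DSM n) : Prop := ∀ lam (d : Fin n → ℂ),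
  C lam * Matrix.diagonal (fun p => d p.2) = Matrix.diagonal (fun p => d p.2) * C lam

/-- total zero-weight condition: `[D₁₂, h⊗1 + 1⊗h] = 0` for all diagonal `h`. -/
def WD (D : DSM n) : Prop := ∀ lam (d : Fin n → ℂ),
  D lam * Matrix.diagonal (fun p => d p.1 + d p.2)
    = Matrix.diagonal (fun p => d p.1 + d p.2) * D lam

/-- The four coupled semi-dynamical Yang–Baxter equations, on `V⊗V⊗V`. -/
def SDYB (A B C D : DSM n) : Prop :=
  (∀ lam, emb2 (ι := Fin 3) (A lam) 0 1 * emb2 (A lam) 0 2 * emb2 (A lam) 1 2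
      = emb2 (A lam) 1 2 * emb2 (A lam) 0 2 * emb2 (A lam) 0 1) ∧
  (∀ lam, dsh {2} (fun mu => emb2 (ι := Fin 3) (D mu) 0 1) lam * emb2 (D lam) 0 2 *
        dsh {0} (fun mu => emb2 (D mu) 1 2) lam
      = emb2 (D lam) 1 2 * dsh {1} (fun mu => emb2 (D mu) 0 2) lam * emb2 (D lam) 0 1) ∧
  (∀ lam, emb2 (ι := Fin 3) (D lam) 0 1 * emb2 (B lam) 0 2 *
        dsh {0} (fun mu => emb2 (B mu) 1 2) lam
      = emb2 (B lam) 1 2 * dsh {1} (fun mu => emb2 (B mu) 0 2) lam * emb2 (D lam) 0 1) ∧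
  (∀ lam, emb2 (ι := Fin 3) (A lam) 0 1 * emb2 (C lam) 0 2 * emb2 (C lam) 1 2
      = emb2 (C lam) 1 2 * emb2 (C lam) 0 2 * dsh {2} (fun mu => emb2 (A mu) 0 1) lam)

/-- Fused semi-dynamical solution
`T_M(λ) = ∏→_{i∈M} ( T_i(λ + h_{{k∈M : k<i}}) ∏→_{j∈M, j>i} B_{ij}(λ) )`. -/
noncomputable def fuseTd (B : DSM n) (T : Lam n → Matrix (Fin n) (Fin n) R)
    (M : List ι) : Lam n → Tens ι n R := fun lam =>
  (M.map fun i =>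
    dsh ((M.takeWhile (fun k => decide (k ≠ i))).toFinset)
        (fun mu => emb1 (T mu) i) lam *
    ((((M.dropWhile (fun k => decide (k ≠ i))).tail).map fun j =>
        emb2 (B lam) i j).prod).map (algebraMap ℂ R)).prod


section SingleSite

variable {ι : Type*} [Fintype ι] [DecidableEq ι]

theorem emb1_mul_apply [Semiring α] (Z : Matrix (Fin n) (Fin n) α) (j : ι) (M : Tens ι n α)
    (f g : ι → Fin n) :
    (emb1 Z j * M) f g = ∑ x, Z (f j) x * M (Function.update f j x) g := by
  rw [Matrix.mul_apply]
  refine (Finset.sum_of_injOn (Function.update f j) (Function.update_injective f j).injOn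
    (by simp) ?_ ?_).symm
  · intro h _ hh
    have : ¬ ∀ k, k ≠ j → f k = h k := by
      intro H
      refine hh ⟨h j, by simp, ?_⟩
      ext k
      by_cases hk : k = j
      · subst hk; simp
      · simp [hk, H k hk]
    simp [emb1, this]
  · intro x _
    have : ∀ k, k ≠ j → f k = Function.update f j x k := fun k hk => by simp [hk]
    simp only [emb1, Matrix.of_apply, if_pos this, Function.update_self]

theorem emb1_mul_emb1_of_ne [Semiring α] (Z W : Matrix (Fin n) (Fin n) α) {i j : ι} (hij : i ≠ j)
    (f g : ι → Fin n) :
    (emb1 Z i * emb1 W j) f g =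
      if ∀ k, k ≠ i → k ≠ j → f k = g k then Z (f i) (g i) * W (f j) (g j) else 0 := by
  rw [emb1_mul_apply, Finset.sum_eq_single (g i)]
  · simp only [emb1, Matrix.of_apply]
    have : (∀ k, k ≠ j → Function.update f i (g i) k = g k) ↔
        ∀ k, k ≠ i → k ≠ j → f k = g k := by
      refine forall_congr' fun k => ?_
      by_cases hk : k = i
      · subst hk; simp
      · simp [hk]
    rw [mul_ite, mul_zero]
    simp only [this, Function.update_of_ne hij.symm]
  · intro x _ hx
    have : ¬ ∀ k, k ≠ j → Function.update f i x k = g k := fun H => hx (by simpa using H i hij)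
    simp [emb1, this]
  · simp

theorem commute_emb1_emb1 [CommSemiring α] (Z W : Matrix (Fin n) (Fin n) α) {i j : ι}
    (hij : i ≠ j) : Commute (emb1 Z i) (emb1 W j) := by
  ext f g
  rw [emb1_mul_emb1_of_ne Z W hij, emb1_mul_emb1_of_ne W Z hij.symm, mul_comm]
  exact if_congr ⟨fun H k hj hi => H k hi hj, fun H k hi hj => H k hj hi⟩ rfl rfl

theorem emb1_mul_emb1 [Semiring α] (Z W : Matrix (Fin n) (Fin n) α) (j : ι) :
    emb1 Z j * emb1 W j = emb1 (Z * W) j := by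
  ext f g
  rw [emb1_mul_apply]
  have : ∀ x, (∀ k, k ≠ j → Function.update f j x k = g k) ↔ ∀ k, k ≠ j → f k = g k :=
    fun x => forall₂_congr fun k hk => by simp [hk]
  simp only [emb1, Matrix.of_apply, this, Function.update_self, Matrix.mul_apply]
  split_ifs <;> simp

theorem emb1_transpose [Zero α] (Z : Matrix (Fin n) (Fin n) α) (j : ι) :
    (emb1 Z j)ᵀ = emb1 Zᵀ j := by
  ext f g
  simp [emb1, eq_comm]

theorem emb1_zero [Zero α] (j : ι) : (emb1 0 j : Tens ι n α) = 0 := by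
  ext f g
  simp [emb1]

theorem emb1_sum [AddCommMonoid α] {κ : Type*} (s : Finset κ)
    (Z : κ → Matrix (Fin n) (Fin n) α) (j : ι) :
    ∑ e ∈ s, emb1 (Z e) j = emb1 (∑ e ∈ s, Z e) j := by
  ext f g
  simp only [emb1, Matrix.sum_apply, Matrix.of_apply]
  split_ifs <;> simp

theorem emb1_one [Zero α] [One α] (j : ι) : (emb1 1 j : Tens ι n α) = 1 := by
  ext f g
  simp only [emb1, Matrix.of_apply, Matrix.one_apply]
  by_cases h : f = g
  · subst h; simp
  · rw [if_neg h]
    split_ifs with h1 h2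
    · refine absurd (funext fun k => ?_) h
      by_cases hk : k = j
      · rw [hk, h2]
      · exact h1 k hk
    all_goals rfl

/-- The one-site matrix `X_{c·,e·}` obtained by fixing the indices of the first factor. -/
def slice (X : M2 n α) (c e : Fin n) : Matrix (Fin n) (Fin n) α :=
  Matrix.of fun s x => X (c, s) (e, x)

/-- `X_{0j}` for an auxiliary site `0` outside `ι`, as a block matrix indexed by that site. -/
noncomputable def siteBlock [Zero α] (X : M2 n α) (j : ι) :
    Matrix (Fin n) (Fin n) (Tens ι n α) :=
  Matrix.of fun c e => emb1 (slice X c e) j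

theorem commute_emb1_prod_siteBlock [CommSemiring α] (X : M2 n α)
    (Z : Matrix (Fin n) (Fin n) α) (j : ι) (L : List ι) (hj : j ∉ L) (c b : Fin n) :
    Commute (emb1 Z j) ((L.map (siteBlock X)).prod c b) := by
  induction L generalizing c with
  | nil =>
    rw [List.map_nil, List.prod_nil, Matrix.one_apply]
    split_ifs
    · exact Commute.one_right _
    · exact Commute.zero_right _
  | cons i L ih =>
    rw [List.mem_cons, not_or] at hj
    rw [List.map_cons, List.prod_cons, Matrix.mul_apply]
    exact Commute.sum_right _ _ _ fun e _ => (commute_emb1_emb1 _ _ hj.1).mul_right (ih hj.2 e)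

/-- If `C` and `B` are dual to each other with respect to contraction of the first column index
and the second row index, then so are the fused products `∏ C_{0j}` and `∏ B_{0j}`. -/
theorem sum_transpose_prod_siteBlock_mul [CommSemiring α] (B C : M2 n α)
    (h : ∀ c' c, ∑ e, (slice C c' e)ᵀ * slice B c e = if c' = c then 1 else 0)
    (L : List ι) (hL : L.Nodup) (c' c : Fin n) :
    ∑ b, ((L.map (siteBlock C)).prod c' b)ᵀ * (L.map (siteBlock B)).prod c b =
      if c' = c then 1 else 0 := by
  induction L generalizing c' c with
  | nil =>
    by_cases hc : c' = c <;> simp [Matrix.one_apply, hc, apply_ite]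
  | cons j L ih =>
    rw [List.nodup_cons] at hL
    set Y := (L.map (siteBlock C)).prod with hY
    set X := (L.map (siteBlock B)).prod with hX
    have step : ∀ b, (((j :: L).map (siteBlock C)).prod c' b)ᵀ *
        ((j :: L).map (siteBlock B)).prod c b =
        ∑ e', ∑ e, (Y e' b)ᵀ * X e b * emb1 ((slice C c' e')ᵀ * slice B c e) j := by
      intro b
      simp only [List.map_cons, List.prod_cons, Matrix.mul_apply (M := siteBlock _ _),
        Matrix.transpose_sum, Matrix.transpose_mul, Finset.sum_mul_sum, ← hX, ← hY]
      refine Finset.sum_congr rfl fun e' _ => Finset.sum_congr rfl fun e _ => ?_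
      have hc := (commute_emb1_prod_siteBlock B ((slice C c' e')ᵀ * slice B c e) j L hL.1 e b).eq
      rw [← hX] at hc
      rw [mul_assoc (Y e' b)ᵀ (X e b), ← hc, ← emb1_mul_emb1, ← emb1_transpose]
      simp only [siteBlock, Matrix.of_apply, mul_assoc]
    simp only [step]
    rw [Finset.sum_comm]
    have : ∀ e', ∑ b, ∑ e, (Y e' b)ᵀ * X e b * emb1 ((slice C c' e')ᵀ * slice B c e) j =
        emb1 ((slice C c' e')ᵀ * slice B c e') j := by
      intro e'
      rw [Finset.sum_comm]
      simp only [← Finset.sum_mul, ih hL.2, ite_mul, one_mul, zero_mul, Finset.sum_ite_eq,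
        Finset.mem_univ, if_true]
    simp only [this, emb1_sum, h]
    split_ifs
    · exact emb1_one j
    · exact emb1_zero j

theorem sum_transpose_slice_mul_slice {S : Type*} [CommRing S] (B : M2 n S)
    (hB : IsUnit (t1 B)) (c' c : Fin n) :
    ∑ e, (slice (t2 (t1 B)⁻¹) c' e)ᵀ * slice B c e = if c' = c then 1 else 0 := by
  have hdet := (Matrix.isUnit_iff_isUnit_det _).mp hB
  ext x y
  have h := congrFun (congrFun (Matrix.nonsing_inv_mul _ hdet) (c', x)) (c, y)
  rw [Matrix.mul_apply, Fintype.sum_prod_type] at h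
  simp only [Matrix.sum_apply, Matrix.mul_apply]
  refine h.trans ?_
  by_cases hc : c' = c <;> simp [hc, Matrix.one_apply]

theorem emb2_map {β : Type*} [Semiring α] [Semiring β] (φ : α →+* β) (X : M2 n α) (i j : ι) :
    (emb2 X i j).map φ = emb2 (X.map φ) i j := by
  ext f g
  simp [emb2, apply_ite φ]

theorem commute_fuseT_apply (B : M2 n ℂ) (K : Matrix (Fin n) (Fin n) R) (x : R)
    (h : ∀ a b, Commute x (K a b)) (L : List ι) (f g : ι → Fin n) :
    Commute x (fuseT B K L f g) := by
  have mul_mem : ∀ M N : Tens ι n R, (∀ f g, Commute x (M f g)) → (∀ f g, Commute x (N f g)) →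
      ∀ f g, Commute x ((M * N) f g) := fun M N hM hN f g =>
    Commute.sum_right _ _ _ fun e _ => (hM f e).mul_right (hN e g)
  have one_mem : ∀ f g, Commute x ((1 : Tens ι n R) f g) := fun f g => by
    rw [Matrix.one_apply]
    split_ifs
    · exact Commute.one_right _
    · exact Commute.zero_right _
  have prod_mem : ∀ (i : ι) (L : List ι) (f g : ι → Fin n),
      Commute x ((L.map fun j => (emb2 B i j).map (algebraMap ℂ R)).prod f g) := by
    intro i L
    induction L with
    | nil => exact one_mem
    | cons j L ih =>
      rw [List.map_cons, List.prod_cons]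
      exact mul_mem _ _ (fun _ _ => (Algebra.commutes _ _).symm) ih
  induction L generalizing f g with
  | nil => exact one_mem f g
  | cons i L ih =>
    refine mul_mem _ _ (mul_mem _ _ (fun f g => ?_) (prod_mem i L)) ih f g
    simp only [emb1, Matrix.of_apply]
    split_ifs
    · exact h _ _
    · exact Commute.zero_right _

end SingleSite

section Cons

variable {k : ℕ}

/-- Separate the first factor: `End(V^{⊗(k+1)}) → End(V) ⊗ End(V^{⊗k})`. -/
def consBlock [Semiring α] (k : ℕ) :
    Tens (Fin (k + 1)) n α →+* Matrix (Fin n) (Fin n) (Tens (Fin k) n α) where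
  toFun M := Matrix.of fun a b => Matrix.of fun p q =>
    M (Fin.cons a p : Fin (k + 1) → Fin n) (Fin.cons b q : Fin (k + 1) → Fin n)
  map_one' := by
    ext a b p q
    by_cases h : a = b <;> simp [Matrix.one_apply, h, Fin.cons_inj]
  map_zero' := rfl
  map_add' _ _ := rfl
  map_mul' M N := by
    ext a b p q
    simp only [Matrix.of_apply, Matrix.mul_apply, Matrix.sum_apply]
    rw [← (Fin.consEquiv fun _ => Fin n).sum_comp, Fintype.sum_prod_type]
    rfl

theorem consBlock_apply [Semiring α] (M : Tens (Fin (k + 1)) n α) (a b : Fin n)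
    (p q : Fin k → Fin n) :
    consBlock k M a b p q =
      M (Fin.cons a p : Fin (k + 1) → Fin n) (Fin.cons b q : Fin (k + 1) → Fin n) := rfl

theorem consBlock_emb1_zero [Semiring α] (T : Matrix (Fin n) (Fin n) α) :
    consBlock k (emb1 T 0) = Matrix.of fun a b => Matrix.scalar _ (T a b) := by
  ext a b p q
  simp [consBlock_apply, emb1, Fin.forall_fin_succ, Matrix.diagonal_apply, funext_iff]

theorem consBlock_emb1_succ [Semiring α] (T : Matrix (Fin n) (Fin n) α) (j : Fin k) :
    consBlock k (emb1 T j.succ) = Matrix.scalar _ (emb1 T j) := by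
  ext a b p q
  by_cases h : a = b <;>
    simp [consBlock_apply, emb1, Fin.forall_fin_succ, h, Fin.succ_ne_zero, eq_comm]

theorem consBlock_emb2_succ [Semiring α] (X : M2 n α) (i j : Fin k) :
    consBlock k (emb2 X i.succ j.succ) = Matrix.scalar _ (emb2 X i j) := by
  ext a b p q
  by_cases h : a = b <;>
    simp [consBlock_apply, emb2, Fin.forall_fin_succ, h, Fin.succ_ne_zero, eq_comm]

theorem consBlock_emb2_zero [Semiring α] (X : M2 n α) (j : Fin k) :
    consBlock k (emb2 X 0 j.succ) = siteBlock X j := by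
  ext a b p q
  simp [consBlock_apply, emb2, siteBlock, slice, emb1, Fin.forall_fin_succ]

theorem consBlock_map {β : Type*} [Semiring α] [Semiring β] (φ : α →+* β)
    (M : Tens (Fin (k + 1)) n α) :
    consBlock k (M.map φ) = (consBlock k M).map fun N => N.map φ := rfl

theorem consBlock_fuseT_map_succ (B : M2 n ℂ) (T : Matrix (Fin n) (Fin n) R)
    (L : List (Fin k)) :
    consBlock k (fuseT B T (L.map Fin.succ)) = Matrix.scalar _ (fuseT B T L) := by
  induction L with
  | nil => simp only [List.map_nil, fuseT, map_one]
  | cons i L ih =>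
    simp only [List.map_cons, fuseT, map_mul, ih, consBlock_emb1_succ, map_list_prod,
      List.map_map, emb2_map]
    congr 4
    funext j
    simp [consBlock_emb2_succ]

theorem consBlock_fuseT_finRange_succ (B : M2 n ℂ) (T : Matrix (Fin n) (Fin n) R)
    (a b : Fin n) (p q : Fin k → Fin n) :
    consBlock k (fuseT B T (List.finRange (k + 1))) a b p q =
      ∑ i : Fin n × (Fin k → Fin n),
        algebraMap ℂ R (((List.finRange k).map (siteBlock B)).prod i.1 b p i.2) *
          (T a i.1 * fuseT B T (List.finRange k) i.2 q) := by
  have hprod : consBlock k (((List.finRange k).map Fin.succ).map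
      fun j => (emb2 B 0 j).map (algebraMap ℂ R)).prod =
      (((List.finRange k).map (siteBlock B)).prod).map fun N => N.map (algebraMap ℂ R) := by
    have : (((List.finRange k).map Fin.succ).map
        fun j => (emb2 B 0 j).map (algebraMap ℂ R)).prod =
        (((List.finRange k).map fun j => emb2 B 0 j.succ).prod).map (algebraMap ℂ R) := by
      have := map_list_prod (algebraMap ℂ R).mapMatrix
        ((List.finRange k).map fun j => (emb2 B 0 j.succ : Tens (Fin (k + 1)) n ℂ))
      rw [RingHom.mapMatrix_apply] at this
      rw [this, List.map_map, List.map_map]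
      rfl
    rw [this, consBlock_map, map_list_prod, List.map_map]
    congr 3
    exact funext fun j => consBlock_emb2_zero B j
  rw [List.finRange_succ]
  simp only [fuseT, map_mul, hprod, consBlock_fuseT_map_succ, consBlock_emb1_zero]
  simp only [Matrix.scalar_apply, Matrix.mul_diagonal]
  rw [Matrix.mul_apply, Fintype.sum_prod_type_right]
  refine Finset.sum_congr rfl fun r _ => ?_
  rw [Matrix.mul_apply, Matrix.sum_apply, Finset.sum_mul]
  refine Finset.sum_congr rfl fun c _ => ?_
  simp only [Matrix.of_apply, Matrix.diagonal_mul, Matrix.map_apply]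
  rw [← Algebra.commutes, mul_assoc]

end Cons

theorem mulVec_map_dotProduct_mulVec_map {l m : Type*} [Fintype l] [Fintype m] [DecidableEq m]
    (Y X : Matrix l m ℂ) (h : Yᵀ * X = 1) (u v : m → R) :
    ∑ b, (∑ i, algebraMap ℂ R (Y b i) * u i) * (∑ j, algebraMap ℂ R (X b j) * v j) =
      ∑ i, u i * v i := by
  simp only [← Algebra.smul_def, Finset.sum_mul_sum, smul_mul_smul_comm]
  rw [Finset.sum_comm]
  refine Finset.sum_congr rfl fun i _ => ?_
  rw [Finset.sum_comm]
  have : ∀ j, ∑ b, (Y b i * X b j) • (u i * v j) = if i = j then u i * v j else 0 := by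
    intro j
    have hij := congrFun (congrFun h i) j
    rw [Matrix.mul_apply, Matrix.one_apply] at hij
    simp only [Matrix.transpose_apply] at hij
    rw [← Finset.sum_smul, hij, ite_smul, one_smul, zero_smul]
  simp [this]

theorem trace_transpose_mul_eq_sum {m : Type*} [Fintype m] [NonUnitalNonAssocSemiring α]
    (M N : Matrix m m α) :
    Matrix.trace (Mᵀ * N) = ∑ i, ∑ j, M i j * N i j := by
  simp only [Matrix.trace, Matrix.diag, Matrix.mul_apply, Matrix.transpose_apply]
  exact Finset.sum_comm

/-- undressed quantum traces decouple into powers of the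
first-order trace. -/
theorem undressed_traces_decouple {n : ℕ} (hn : 1 ≤ n) (k : ℕ)
    {R : Type*} [Ring R] [Algebra ℂ R]
    (B : M2 n ℂ) (hB1 : IsUnit (t1 B))
    (T K : Matrix (Fin n) (Fin n) R)
    (hcomm : ∀ a b c d, Commute (T a b) (K c d)) :
    Matrix.trace ((fuseT (t2 ((t1 B)⁻¹)) K (List.finRange k))ᵀ *
        fuseT B T (List.finRange k))
      = (Matrix.trace (Kᵀ * T)) ^ k := by
  induction k with
  | zero => simp [fuseT, Matrix.trace]
  | succ k ih =>
    set C := t2 (t1 B)⁻¹ with hC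
    set S' := fuseT C K (List.finRange k) with hS'
    set S := fuseT B T (List.finRange k) with hS
    rw [pow_succ', ← ih]
    let X : Matrix (Fin n × (Fin k → Fin n)) (Fin n × (Fin k → Fin n)) ℂ :=
      Matrix.of fun b i => ((List.finRange k).map (siteBlock B)).prod i.1 b.1 b.2 i.2
    let Y : Matrix (Fin n × (Fin k → Fin n)) (Fin n × (Fin k → Fin n)) ℂ :=
      Matrix.of fun b i => ((List.finRange k).map (siteBlock C)).prod i.1 b.1 b.2 i.2
    have hYX : Yᵀ * X = 1 := by
      ext ⟨c', r'⟩ ⟨c, r⟩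
      have h := congrFun (congrFun (sum_transpose_prod_siteBlock_mul B C
        (sum_transpose_slice_mul_slice B hB1) _ (List.nodup_finRange k) c' c) r') r
      simp only [Matrix.sum_apply, Matrix.mul_apply] at h
      rw [Matrix.mul_apply, Fintype.sum_prod_type]
      refine h.trans ?_
      by_cases hc : c' = c <;> simp [hc, Matrix.one_apply]
    have key : ∀ a q, ∑ b, ∑ p, consBlock k (fuseT C K (List.finRange (k + 1))) a b p q *
        consBlock k (fuseT B T (List.finRange (k + 1))) a b p q =
        ∑ c, ∑ r, K a c * T a c * (S' r q * S r q) := by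
      intro a q
      simp only [consBlock_fuseT_finRange_succ, ← Fintype.sum_prod_type']
      refine (mulVec_map_dotProduct_mulVec_map Y X hYX (fun i => K a i.1 * S' i.2 q)
        (fun i => T a i.1 * S i.2 q)).trans ?_
      refine Finset.sum_congr rfl fun i _ => ?_
      have hc : Commute (T a i.1) (S' i.2 q) :=
        commute_fuseT_apply C K _ (fun c d => hcomm a i.1 c d) _ _ _
      exact hc.symm.mul_mul_mul_comm _ _
    simp only [trace_transpose_mul_eq_sum]
    simp only [← (Fin.consEquiv fun _ => Fin n).sum_comp, Fintype.sum_prod_type]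
    trans ∑ a, ∑ q, ∑ b, ∑ p, consBlock k (fuseT C K (List.finRange (k + 1))) a b p q *
        consBlock k (fuseT B T (List.finRange (k + 1))) a b p q
    · refine Finset.sum_congr rfl fun a _ => ?_
      refine Finset.sum_comm.trans (Eq.trans ?_ Finset.sum_comm)
      exact Finset.sum_congr rfl fun b _ => Finset.sum_comm
    · simp only [key, ← Finset.mul_sum, ← Finset.sum_mul]
      exact congrArg _ Finset.sum_comm

end QT
end

section
/- Suppose the structure matrices A, B, C, D : ℂⁿ → End(V⊗V) satisfy the weight conditions and the semi-dynamical Yang–Baxter equations. Then for all pairwise disjoint ordered label sets M, N′, L″ the fused semi-dynamical Yang–Baxter equations hold as identities of End(V^{⊗(M∪N′∪L″)})-valued functions of λ: A_{MN̄′}A_{ML̄″}A_{N′L̄″} = A_{N′L̄″}A_{ML̄″}A_{MN̄′}; A_{MN̄′}C_{ML″}C_{N′L″} = C_{N′L″}C_{ML″}A_{MN̄′}(λ+h_{L″}); D_{MN̄′}(λ+h_{L″})D_{ML̄″}D_{N′L̄″}(λ+h_M) = D_{N′L̄″}D_{ML̄″}(λ+h_{N′})D_{MN̄′}; D_{MN̄′}B_{ML″}B_{N′L″}(λ+h_M)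 = B_{N′L″}B_{ML″}(λ+h_{N′})D_{MN̄′}. Moreover fusion preserves the weight conditions: B_{MN′} is diagonal in the factors labelled by M, C_{MN′} is diagonal in the factors labelled by N′, and D_{MN̄′} has total zero weight. -/
open Matrix

namespace QT

variable {n : ℕ} {ι : Type*} [Fintype ι] [DecidableEq ι] {α : Type*}
variable {R : Type*} [Ring R] [Algebra ℂ R]

set_option linter.unusedSectionVars false

/-! ### Shifted matrix-valued functions -/

/-- The shift of a matrix-valued function by a vector read off the row indices. -/
def sh (φ : (ι → Fin n) → Lam n) (X : Lam n → Tens ι n ℂ) : Lam n → Tens ι n ℂ :=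
  fun lam => Matrix.of fun f g => X (lam + φ f) f g

/-- The total weight `h_M` read off the indices at the factors in the list `M`. -/
noncomputable def wt (M : List ι) (f : ι → Fin n) : Lam n := (M.map fun k => ee (f k)).sum

/-- `X` only connects indices with the same value of `φ`. -/
def Pres (φ : (ι → Fin n) → Lam n) (X : Lam n → Tens ι n ℂ) : Prop :=
  ∀ lam f g, X lam f g ≠ 0 → φ f = φ g

section Shift

variable {φ ψ : (ι → Fin n) → Lam n} {X Y : Lam n → Tens ι n ℂ}

lemma sh_apply (lam : Lam n) (f g : ι → Fin n) :
    sh φ X lam f g = X (lam + φ f) f g := rfl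

lemma sh_sh : sh φ (sh ψ X) = sh (φ + ψ) X := by
  funext lam; ext f g; simp [sh_apply, add_assoc]

lemma sh_comm : sh φ (sh ψ X) = sh ψ (sh φ X) := by
  rw [sh_sh, sh_sh, add_comm]

@[simp] lemma sh_zero : sh 0 X = X := by
  funext lam; ext f g; simp [sh_apply]

@[simp] lemma sh_one : sh φ (1 : Lam n → Tens ι n ℂ) = 1 := by
  funext lam; ext f g; simp [sh_apply]

lemma sh_mul (h : Pres φ X) : sh φ (X * Y) = sh φ X * sh φ Y := by
  funext lam; ext f g
  simp only [sh_apply, Pi.mul_apply, Matrix.mul_apply]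
  refine Finset.sum_congr rfl fun k _ => ?_
  by_cases hx : X (lam + φ f) f k = 0
  · simp [hx]
  · rw [h _ _ _ hx]

lemma Pres.sh (h : Pres φ X) : Pres φ (sh ψ X) := fun _ f g hx => h _ f g hx

lemma Pres.mul (hX : Pres φ X) (hY : Pres φ Y) : Pres φ (X * Y) := by
  intro lam f g hne
  obtain ⟨k, -, hk⟩ := Finset.exists_ne_zero_of_sum_ne_zero
    (show ∑ k, X lam f k * Y lam k g ≠ 0 from hne)
  exact (hX _ _ _ (left_ne_zero_of_mul hk)).trans (hY _ _ _ (right_ne_zero_of_mul hk))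

lemma Pres.one : Pres φ (1 : Lam n → Tens ι n ℂ) := by
  intro lam f g hne
  have : f = g := by
    by_contra h
    exact hne (by simp [h])
  rw [this]

lemma Pres.add (hφ : Pres φ X) (hψ : Pres ψ X) : Pres (φ + ψ) X := fun lam f g hne => by
  simp [hφ lam f g hne, hψ lam f g hne]

lemma Pres.zero : Pres 0 X := fun _ _ _ _ => rfl

lemma sh_commute (hXY : ∀ lam mu, X lam * Y mu = Y mu * X lam) (hX : Pres ψ X)
    (hY : Pres φ Y) : sh φ X * sh ψ Y = sh ψ Y * sh φ X := by
  funext lam; ext f g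
  have h := congrFun (congrFun (hXY (lam + φ f) (lam + ψ f)) f) g
  simp only [Matrix.mul_apply] at h
  simp only [Pi.mul_apply, Matrix.mul_apply, sh_apply]
  calc _ = ∑ k, X (lam + φ f) f k * Y (lam + ψ f) k g :=
        Finset.sum_congr rfl fun k _ => by
          by_cases hx : X (lam + φ f) f k = 0
          · simp [hx]
          · rw [hX _ _ _ hx]
    _ = _ := h
    _ = _ := Finset.sum_congr rfl fun k _ => by
          by_cases hy : Y (lam + ψ f) f k = 0
          · simp [hy]
          · rw [hY _ _ _ hy]

@[simp] lemma wt_nil : wt ([] : List ι) = (0 : (ι → Fin n) → Lam n) := by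
  funext f; simp [wt]

lemma wt_cons (i : ι) (M : List ι) :
    wt (i :: M) = (wt [i] + wt M : (ι → Fin n) → Lam n) := by
  funext f; simp [wt]

lemma wt_append (M N : List ι) :
    wt (M ++ N) = (wt M + wt N : (ι → Fin n) → Lam n) := by
  funext f; simp [wt]

lemma sh_wt_cons (q : ℂ) (i : ι) (M : List ι) :
    sh (q • wt (i :: M)) X = sh (q • wt [i]) (sh (q • wt M) X) := by
  rw [wt_cons, smul_add, sh_sh]

lemma shL_toFinset {M : List ι} (hM : M.Nodup) (f : ι → Fin n) :
    shL M.toFinset f = wt M f := List.sum_toFinset _ hM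

lemma dsh_toFinset {M : List ι} (hM : M.Nodup) : dsh M.toFinset X = sh (wt M) X := by
  funext lam; ext f g; simp [dsh, sh_apply, shL_toFinset hM]

lemma dsh_singleton (i : ι) : dsh {i} X = sh (wt [i]) X := by
  simpa using dsh_toFinset (X := X) (List.nodup_singleton i)

end Shift

/-! ### Operators acting on a subset of the factors -/

section Lift

variable {κ κ' : Type*} [Fintype κ] [DecidableEq κ] [Fintype κ'] [DecidableEq κ']

open scoped Classical in
/-- The operator acting as `x` on the factors in the range of `e`, and as the identity
on the others. -/
noncomputable def lift (e : κ → ι) (x : Lam n → Tens κ n ℂ) : Lam n → Tens ι n ℂ :=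
  fun lam => Matrix.of fun f g =>
    if ∀ k, (∀ a, e a ≠ k) → f k = g k then x lam (f ∘ e) (g ∘ e) else 0

open scoped Classical in
lemma lift_apply (e : κ → ι) (x : Lam n → Tens κ n ℂ) (lam : Lam n) (f g : ι → Fin n) :
    lift e x lam f g =
      if ∀ k, (∀ a, e a ≠ k) → f k = g k then x lam (f ∘ e) (g ∘ e) else 0 := rfl

lemma lift_mul {e : κ → ι} (he : Function.Injective e) (x y : Lam n → Tens κ n ℂ) :
    lift e (x * y) = lift e x * lift e y := by
  classical
  funext lam; ext f g
  simp only [Pi.mul_apply, Matrix.mul_apply, lift_apply]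
  split_ifs with h
  · symm
    refine Finset.sum_bij_ne_zero (fun a _ _ => a ∘ e) (fun _ _ _ => Finset.mem_univ _)
      ?_ ?_ ?_
    · intro a _ ha b _ hb hab
      funext k
      by_cases hk : ∀ c, e c ≠ k
      · rw [ne_eq, mul_eq_zero, not_or] at ha hb
        have h1 := of_not_not fun hc => ha.1 (if_neg hc)
        have h2 := of_not_not fun hc => hb.1 (if_neg hc)
        rw [← h1 k hk, ← h2 k hk]
      · push Not at hk
        obtain ⟨c, rfl⟩ := hk
        exact congrFun hab c
    · intro b _ hb
      have hext : ∀ k, (∀ a, e a ≠ k) → Function.extend e b f k = f k := fun k hk =>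
        Function.extend_apply' _ _ _ (by rintro ⟨a, rfl⟩; exact hk a rfl)
      have hcomp : Function.extend e b f ∘ e = b := by
        funext a; exact he.extend_apply _ _ _
      refine ⟨Function.extend e b f, Finset.mem_univ _, ?_, hcomp⟩
      rw [if_pos fun k hk => (hext k hk).symm,
        if_pos fun k hk => (hext k hk).trans (h k hk), hcomp]
      exact hb
    · intro a _ ha
      rw [ne_eq, mul_eq_zero, not_or] at ha
      rw [if_pos (of_not_not fun hc => ha.1 (if_neg hc)),
        if_pos (of_not_not fun hc => ha.2 (if_neg hc))]
  · symm
    refine Finset.sum_eq_zero fun a _ => ?_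
    by_contra ha
    rw [mul_eq_zero, not_or] at ha
    have h1 := of_not_not fun hc => ha.1 (if_neg hc)
    have h2 := of_not_not fun hc => ha.2 (if_neg hc)
    exact h fun k hk => (h1 k hk).trans (h2 k hk)

lemma lift_one {e : κ → ι} : lift e (1 : Lam n → Tens κ n ℂ) = 1 := by
  classical
  funext lam; ext f g
  simp only [lift_apply, Pi.one_apply, Matrix.one_apply]
  have : f = g ↔ (∀ k, (∀ a, e a ≠ k) → f k = g k) ∧ f ∘ e = g ∘ e := by
    refine ⟨by rintro rfl; simp, fun h => funext fun k => ?_⟩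
    by_cases hk : ∀ c, e c ≠ k
    · exact h.1 k hk
    · push Not at hk
      obtain ⟨c, rfl⟩ := hk
      exact congrFun h.2 c
  simp only [this]
  split_ifs <;> simp_all

lemma lift_sh {e : κ → ι} {φ : (ι → Fin n) → Lam n} {φ' : (κ → Fin n) → Lam n}
    (h : ∀ f, φ f = φ' (f ∘ e)) (x : Lam n → Tens κ n ℂ) :
    lift e (sh φ' x) = sh φ (lift e x) := by
  funext lam; ext f g
  simp only [lift_apply, sh_apply, h]

lemma lift_emb2 {e : κ → ι} (he : Function.Injective e) (X : DSM n) (a b : κ) :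
    lift e (fun lam => emb2 (X lam) a b) = fun lam => emb2 (X lam) (e a) (e b) := by
  funext lam; ext f g
  simp only [lift_apply, emb2, Matrix.of_apply, Function.comp_apply]
  rw [← ite_and]
  refine if_congr ⟨fun h k hi hj => ?_, fun h => ⟨fun k hk => ?_, fun k hi hj => ?_⟩⟩ rfl rfl
  · by_cases hk : ∀ c, e c ≠ k
    · exact h.1 k hk
    · push Not at hk
      obtain ⟨c, rfl⟩ := hk
      exact h.2 c (fun hc => hi (by rw [hc])) (fun hc => hj (by rw [hc]))
  · exact h k (hk a).symm (hk b).symm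
  · exact h _ (he.ne hi) (he.ne hj)

lemma lift_mul_lift_apply {e : κ → ι} {e' : κ' → ι} (hd : ∀ a b, e a ≠ e' b)
    (x : Lam n → Tens κ n ℂ) (y : Lam n → Tens κ' n ℂ) (lam mu : Lam n) (f g : ι → Fin n) :
    (lift e x lam * lift e' y mu) f g =
      open scoped Classical in
      if ∀ k, (∀ a, e a ≠ k) → (∀ b, e' b ≠ k) → f k = g k then
        x lam (f ∘ e) (g ∘ e) * y mu (f ∘ e') (g ∘ e') else 0 := by
  classical
  simp only [Matrix.mul_apply, lift_apply]
  split_ifs with h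
  · let m : ι → Fin n := fun k => if ∀ a, e a ≠ k then f k else g k
    have hme : m ∘ e = g ∘ e := by
      funext a; simp [m]
    have hme' : m ∘ e' = f ∘ e' := by
      funext b; simp [m, hd]
    rw [Finset.sum_eq_single m]
    · rw [if_pos, if_pos, hme, hme']
      · intro k hk
        by_cases hk' : ∀ a, e a ≠ k
        · simp only [m, if_pos hk', h k hk' hk]
        · simp only [m, if_neg hk']
      · intro k hk
        simp only [m, if_pos hk]
    · intro a _ ha
      by_contra hne
      rw [mul_eq_zero, not_or] at hne
      have h1 := of_not_not fun hc => hne.1 (if_neg hc)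
      have h2 := of_not_not fun hc => hne.2 (if_neg hc)
      refine ha (funext fun k => ?_)
      by_cases hk : ∀ a, e a ≠ k
      · simp only [m, if_pos hk, h1 k hk]
      · simp only [m, if_neg hk]
        push Not at hk
        obtain ⟨c, rfl⟩ := hk
        exact h2 _ fun b => (hd c b).symm
    · simp
  · refine Finset.sum_eq_zero fun a _ => ?_
    by_contra ha
    rw [mul_eq_zero, not_or] at ha
    have h1 := of_not_not fun hc => ha.1 (if_neg hc)
    have h2 := of_not_not fun hc => ha.2 (if_neg hc)
    exact h fun k hk hk' => (h1 k hk).trans (h2 k hk')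

lemma lift_commute {e : κ → ι} {e' : κ' → ι} (hd : ∀ a b, e a ≠ e' b)
    (x : Lam n → Tens κ n ℂ) (y : Lam n → Tens κ' n ℂ) (lam mu : Lam n) :
    lift e x lam * lift e' y mu = lift e' y mu * lift e x lam := by
  ext f g
  rw [lift_mul_lift_apply hd, lift_mul_lift_apply fun b a => (hd a b).symm]
  refine if_congr ⟨fun h k h1 h2 => h k h2 h1, fun h k h1 h2 => h k h2 h1⟩ (mul_comm _ _) rfl

end Lift

/-- `X` acts as the identity outside the factors labelled by `J`. -/
def Supp (J : List ι) (X : Lam n → Tens ι n ℂ) : Prop :=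
  ∃ x : Lam n → Tens {k // k ∈ J} n ℂ, X = lift Subtype.val x

namespace Supp

variable {J J' : List ι} {X Y : Lam n → Tens ι n ℂ}

lemma one : Supp J (1 : Lam n → Tens ι n ℂ) := ⟨1, lift_one.symm⟩

lemma mul (hX : Supp J X) (hY : Supp J Y) : Supp J (X * Y) := by
  obtain ⟨x, rfl⟩ := hX
  obtain ⟨y, rfl⟩ := hY
  exact ⟨x * y, (lift_mul Subtype.val_injective x y).symm⟩

lemma emb2 (X : DSM n) {i j : ι} (hi : i ∈ J) (hj : j ∈ J) :
    Supp J fun lam => emb2 (X lam) i j :=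
  ⟨_, (lift_emb2 (κ := {k // k ∈ J}) Subtype.val_injective X ⟨i, hi⟩ ⟨j, hj⟩).symm⟩

lemma sh (hX : Supp J X) (q : ℂ) {M : List ι} (hM : ∀ k ∈ M, k ∈ J) :
    Supp J (sh (q • wt M) X) := by
  obtain ⟨x, rfl⟩ := hX
  refine ⟨_, (lift_sh (φ' := q • wt (M.attach.map fun k => ⟨k.1, hM k.1 k.2⟩))
    (fun f => ?_) x).symm⟩
  simp only [Pi.smul_apply, wt, List.map_map, Function.comp_def]
  rw [List.map_attach_eq_pmap]
  simp only [List.pmap_eq_map]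

lemma commute (hX : Supp J X) (hY : Supp J' Y) (h : ∀ k ∈ J, k ∉ J') (lam mu : Lam n) :
    X lam * Y mu = Y mu * X lam := by
  obtain ⟨x, rfl⟩ := hX
  obtain ⟨y, rfl⟩ := hY
  exact lift_commute (fun a b hab => h a.1 a.2 (hab ▸ b.2)) _ _ _ _

lemma pres (hX : Supp J X) (q : ℂ) {M : List ι} (h : ∀ k ∈ M, k ∉ J) :
    Pres (q • wt M) X := by
  obtain ⟨x, rfl⟩ := hX
  intro lam f g hne
  have h1 := of_not_not fun hc => hne (if_neg hc)
  have : M.map (fun k => (ee (f k) : Lam n)) = M.map fun k => ee (g k) :=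
    List.map_congr_left fun k hk => by rw [h1 k fun a ha => h k hk (ha ▸ a.2)]
  simp [wt, this]

lemma sh_commute (hX : Supp J X) (hY : Supp J' Y) (h : ∀ k ∈ J, k ∉ J')
    {φ ψ : (ι → Fin n) → Lam n} (hXψ : Pres ψ X) (hYφ : Pres φ Y) :
    QT.sh φ X * QT.sh ψ Y = QT.sh ψ Y * QT.sh φ X :=
  QT.sh_commute (hX.commute hY h) hXψ hYφ

end Supp

/-! ### Abstract fusion -/

/-- The properties of a fused family `Y_{ML}` in which sites of the first label set are
added with a shift of strength `q`, and which preserves `q h_M + p h_L` and `r h_L`. -/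
structure Fused (p q r : ℂ) (Y : List ι → List ι → Lam n → Tens ι n ℂ) : Prop where
  nil_left : ∀ L, Y [] L = 1
  nil_right : ∀ M, Y M [] = 1
  cons_left : ∀ i M L, Y (i :: M) L = Y [i] L * sh (q • wt [i]) (Y M L)
  supp : ∀ {M L J : List ι}, M ⊆ J → L ⊆ J → Supp J (Y M L)
  pres : ∀ {M L : List ι}, (M ++ L).Nodup → Pres (q • wt M + p • wt L) (Y M L)
  pres_right : ∀ {M L : List ι}, (M ++ L).Nodup → Pres (r • wt L) (Y M L)

/-- The general form of the fused semi-dynamical Yang–Baxter equations. -/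
def YBE (p q r : ℂ) (X Y : List ι → List ι → Lam n → Tens ι n ℂ) (M N L : List ι) : Prop :=
  sh (p • wt L) (X M N) * Y M L * sh (q • wt M) (Y N L) =
    Y N L * sh (q • wt N) (Y M L) * sh (r • wt L) (X M N)

/-- Fusing two exchange relations with a common element. -/
lemma exchange_fusion {W : Type*} [Monoid W] {a b c d e z₁ z₂ z₃ t₁ t₂ t₃ : W}
    (hcd : c * d = d * c) (h₁ : a * b * d = z₁ * z₂ * z₃)
    (h₂ : z₃ * c * e = t₁ * t₂ * t₃) (hzt : z₂ * t₁ = t₁ * z₂) :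
    a * (b * c) * (d * e) = z₁ * t₁ * (z₂ * t₂) * t₃ := by
  calc a * (b * c) * (d * e) = a * b * (c * d) * e := by simp only [mul_assoc]
    _ = a * b * d * c * e := by rw [hcd]; simp only [mul_assoc]
    _ = z₁ * z₂ * (z₃ * c * e) := by rw [h₁]; simp only [mul_assoc]
    _ = z₁ * (z₂ * t₁) * t₂ * t₃ := by rw [h₂]; simp only [mul_assoc]
    _ = _ := by rw [hzt]; simp only [mul_assoc]

lemma exchange_fusion_left {W : Type*} [Monoid W] {a b c d e z₁ z₂ z₃ t₁ t₂ t₃ : W}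
    (hbc : b * c = c * b) (h₁ : b * d * e = z₁ * z₂ * z₃)
    (h₂ : a * c * z₁ = t₁ * t₂ * t₃) (hzt : t₃ * z₂ = z₂ * t₃) :
    a * b * (c * d) * e = t₁ * (t₂ * z₂) * (t₃ * z₃) := by
  calc a * b * (c * d) * e = a * (b * c) * d * e := by simp only [mul_assoc]
    _ = a * c * (b * d * e) := by rw [hbc]; simp only [mul_assoc]
    _ = a * c * z₁ * z₂ * z₃ := by rw [h₁]; simp only [mul_assoc]
    _ = t₁ * t₂ * (t₃ * z₂) * z₃ := by rw [h₂]; simp only [mul_assoc]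
    _ = _ := by rw [hzt]; simp only [mul_assoc]

lemma exchange_fusion_mid {W : Type*} [Monoid W] {a b c d e z₁ z₂ z₃ t₁ t₂ t₃ : W}
    (haz : a * z₁ = z₁ * a) (h₁ : b * c * d = z₁ * z₂ * z₃)
    (h₂ : a * z₂ * e = t₁ * t₂ * t₃) (hze : z₃ * e = e * z₃) :
    a * b * c * (d * e) = z₁ * t₁ * t₂ * (t₃ * z₃) := by
  calc a * b * c * (d * e) = a * (b * c * d) * e := by simp only [mul_assoc]
    _ = a * z₁ * z₂ * (z₃ * e) := by rw [h₁]; simp only [mul_assoc]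
    _ = z₁ * (a * z₂ * e) * z₃ := by rw [haz, hze]; simp only [mul_assoc]
    _ = _ := by rw [h₂]; simp only [mul_assoc]

section Fusion

variable {p q r : ℂ} {X Y : List ι → List ι → Lam n → Tens ι n ℂ}

namespace Fused

lemma pres_off (hY : Fused p q r Y) {M N L : List ι} (s : ℂ)
    (h : ∀ k ∈ N, k ∉ M ∧ k ∉ L) : Pres (s • wt N) (Y M L) :=
  (hY.supp (J := M ++ L) (by simp) (by simp)).pres s (by simpa using h)

lemma commute {p' q' r' : ℂ} (hX : Fused p' q' r' X) (hY : Fused p q r Y)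
    {M N K L : List ι} (h : ∀ k, k ∈ M ∨ k ∈ N → k ∉ K ∧ k ∉ L)
    {φ ψ : (ι → Fin n) → Lam n} (hXψ : Pres ψ (X M N)) (hYφ : Pres φ (Y K L)) :
    sh φ (X M N) * sh ψ (Y K L) = sh ψ (Y K L) * sh φ (X M N) :=
  (hX.supp (J := M ++ N) (by simp) (by simp)).sh_commute
    (hY.supp (J := K ++ L) (by simp) (by simp)) (by simpa using h) hXψ hYφ

lemma commute_left {p' q' r' : ℂ} (hX : Fused p' q' r' X) (hY : Fused p q r Y)
    {M N K L : List ι} (h : ∀ k, k ∈ M ∨ k ∈ N → k ∉ K ∧ k ∉ L)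
    {φ : (ι → Fin n) → Lam n} (hYφ : Pres φ (Y K L)) :
    sh φ (X M N) * Y K L = Y K L * sh φ (X M N) := by
  have := hX.commute hY h Pres.zero hYφ
  rwa [sh_zero] at this

end Fused

lemma YBE.cons_left (hX : Fused q q 0 X) (hY : Fused p q r Y) {i : ι} {M N L : List ι}
    (hd : (i :: M ++ N ++ L).Nodup) (h₁ : YBE p q r X Y [i] N L) (h₂ : YBE p q r X Y M N L) :
    YBE p q r X Y (i :: M) N L := by
  unfold YBE at *
  have h₃ := congrArg (sh (q • wt [i])) h₂
  rw [sh_mul ((hX.pres_off q (by grind)).sh.mul (hY.pres_off q (by grind))),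
    sh_mul (hX.pres_off q (by grind)).sh,
    sh_mul ((hY.pres_off q (by grind)).mul (hY.pres_off q (by grind)).sh),
    sh_mul (hY.pres_off q (by grind)), sh_comm (ψ := p • wt L), sh_comm (ψ := q • wt N),
    sh_comm (ψ := r • wt L)] at h₃
  rw [hX.cons_left, hY.cons_left i M L, sh_wt_cons q i M, sh_mul (hX.pres_off p (by grind)),
    sh_mul (hX.pres_off r (by grind)), sh_mul (hY.pres_off q (by grind))]
  refine exchange_fusion_left ?_ h₃ h₁ ?_
  · rw [sh_sh, add_comm]
    exact hX.commute_left hY (by grind) (hY.pres (by grind))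
  · rw [sh_sh, ← smul_add, add_comm, smul_add]
    exact hX.commute hY (by grind) (hX.pres (by grind)) (hY.pres_right (by grind))

lemma YBE.cons_mid (hX : Fused q q 0 X) (hY : Fused p q r Y) {M N L : List ι} {j : ι}
    (hXr : X M (j :: N) = sh (q • wt [j]) (X M N) * X M [j])
    (hd : (M ++ j :: N ++ L).Nodup) (h₁ : YBE p q r X Y M [j] L) (h₂ : YBE p q r X Y M N L) :
    YBE p q r X Y M (j :: N) L := by
  unfold YBE at *
  have h₃ := congrArg (sh (q • wt [j])) h₂
  rw [sh_mul ((hX.pres_off q (by grind)).sh.mul (hY.pres_off q (by grind))),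
    sh_mul (hX.pres_off q (by grind)).sh,
    sh_mul ((hY.pres_off q (by grind)).mul (hY.pres_off q (by grind)).sh),
    sh_mul (hY.pres_off q (by grind)), sh_comm (ψ := p • wt L), sh_comm (ψ := q • wt M),
    sh_comm (ψ := r • wt L)] at h₃
  rw [hXr, hY.cons_left j N L, sh_wt_cons q j N, sh_mul (hX.pres_off p (by grind)).sh,
    sh_mul (hX.pres_off r (by grind)).sh, sh_mul (hY.pres_off q (by grind))]
  refine (exchange_fusion_mid ?_ h₁ h₃ ?_).trans (by rw [mul_assoc (Y [j] L)])
  · rw [sh_sh, add_comm]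
    exact hX.commute_left hY (by grind) (hY.pres (by grind))
  · rw [sh_sh]
    exact hX.commute hY (by grind) (hX.pres (by grind)) (hY.pres_right (by grind))

lemma YBE.cons_right_rev (hX : Fused q q 0 X) (hY : Fused q q 0 Y) {M N L : List ι} {j : ι}
    (hYM : Y M (j :: L) = sh (q • wt [j]) (Y M L) * Y M [j])
    (hYN : Y N (j :: L) = sh (q • wt [j]) (Y N L) * Y N [j])
    (hd : (M ++ N ++ j :: L).Nodup) (h₁ : YBE q q 0 X Y M N [j]) (h₂ : YBE q q 0 X Y M N L) :
    YBE q q 0 X Y M N (j :: L) := by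
  unfold YBE at *
  have h₃ := congrArg (sh (q • wt [j])) h₂
  rw [sh_mul ((hX.pres_off q (by grind)).sh.mul (hY.pres_off q (by grind))),
    sh_mul (hX.pres_off q (by grind)).sh,
    sh_mul ((hY.pres_off q (by grind)).mul (hY.pres_off q (by grind)).sh),
    sh_mul (hY.pres_off q (by grind)), sh_comm (ψ := q • wt M), sh_comm (ψ := q • wt N)] at h₃
  simp only [zero_smul, sh_zero] at h₁ h₃ ⊢
  rw [hYM, hYN, sh_wt_cons q j L, sh_mul (hY.pres_off q (by grind)).sh,
    sh_mul (hY.pres_off q (by grind)).sh]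
  refine exchange_fusion ?_ h₃ h₁ ?_
  · rw [sh_sh]
    exact (hY.commute_left hY (by grind) (hY.pres (by grind))).symm
  · rw [sh_sh]
    exact hY.commute_left hY (by grind) (hY.pres (by grind))

lemma YBE.cons_right_fwd (hX : Fused q q 0 X) (hY : Fused 0 q r Y) {M N L : List ι} {j : ι}
    (hYM : Y M (j :: L) = Y M [j] * sh (r • wt [j]) (Y M L))
    (hYN : Y N (j :: L) = Y N [j] * sh (r • wt [j]) (Y N L))
    (hd : (M ++ N ++ j :: L).Nodup) (h₁ : YBE 0 q r X Y M N [j]) (h₂ : YBE 0 q r X Y M N L) :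
    YBE 0 q r X Y M N (j :: L) := by
  unfold YBE at *
  have h₃ := congrArg (sh (r • wt [j])) h₂
  rw [sh_mul ((hX.pres_off r (by grind)).sh.mul (hY.pres_off r (by grind))),
    sh_mul (hX.pres_off r (by grind)).sh,
    sh_mul ((hY.pres_off r (by grind)).mul (hY.pres_off r (by grind)).sh),
    sh_mul (hY.pres_off r (by grind)), sh_comm (ψ := q • wt M), sh_comm (ψ := q • wt N)] at h₃
  simp only [zero_smul, sh_zero] at h₁ h₃ ⊢
  rw [hYM, hYN, sh_wt_cons r j L, sh_mul (hY.pres_off q (by grind)),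
    sh_mul (hY.pres_off q (by grind))]
  have hq : ∀ {M L : List ι}, (M ++ L).Nodup → Pres (q • wt M) (Y M L) := fun h => by
    simpa using hY.pres h
  refine exchange_fusion ?_ h₁ h₃ ?_
  · exact hY.commute hY (by grind) (hq (by grind)) (hY.pres_right (by grind))
  · exact hY.commute hY (by grind) (hY.pres_right (by grind)) (hq (by grind))

/-- The fused equations follow from those where the first two label sets are singletons. -/
lemma YBE.of_singleton (hX : Fused q q 0 X) (hY : Fused p q r Y)
    (hXr : ∀ i j N, (i :: j :: N).Nodup → X [i] (j :: N) = sh (q • wt [j]) (X [i] N) * X [i] [j])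
    (h : ∀ i j L, ([i] ++ [j] ++ L).Nodup → YBE p q r X Y [i] [j] L) :
    ∀ M N L, (M ++ N ++ L).Nodup → YBE p q r X Y M N L := by
  intro M N L
  have h₁ : ∀ i N, ([i] ++ N ++ L).Nodup → YBE p q r X Y [i] N L := by
    intro i N
    induction N with
    | nil => intro _; simp [YBE, hX.nil_right, hY.nil_left]
    | cons j N ih =>
      intro hd
      exact YBE.cons_mid hX hY (hXr i j N (by grind)) hd (h i j L (by grind)) (ih (by grind))
  induction M with
  | nil => intro _; simp [YBE, hX.nil_left, hY.nil_left]
  | cons i M ih =>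
    intro hd
    exact YBE.cons_left hX hY hd (h₁ i N (by grind)) (ih (by grind))

end Fusion

/-! ### Concrete fused families -/

/-- Fusion of the second label set, the last sites to the right. -/
noncomputable def fuseFwd (r : ℂ) (U : ι → ι → Lam n → Tens ι n ℂ) (i : ι) :
    List ι → Lam n → Tens ι n ℂ
  | [] => 1
  | j :: L => U i j * sh (r • wt [j]) (fuseFwd r U i L)

/-- Fusion of the second label set, the last sites to the left. -/
noncomputable def fuseRev (q : ℂ) (U : ι → ι → Lam n → Tens ι n ℂ) (i : ι) :
    List ι → Lam n → Tens ι n ℂ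
  | [] => 1
  | j :: L => sh (q • wt [j]) (fuseRev q U i L) * U i j

/-- Fusion of the first label set. -/
noncomputable def fuseLeft (q : ℂ) (V : ι → List ι → Lam n → Tens ι n ℂ) :
    List ι → List ι → Lam n → Tens ι n ℂ
  | [], _ => 1
  | i :: M, L => V i L * sh (q • wt [i]) (fuseLeft q V M L)

section Families

variable {p q r : ℂ} {U : ι → ι → Lam n → Tens ι n ℂ} {V : ι → List ι → Lam n → Tens ι n ℂ}

lemma fuseLeft_singleton (i : ι) (L : List ι) : fuseLeft q V [i] L = V i L := by
  simp [fuseLeft]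

lemma fuseFwd_singleton (i j : ι) : fuseFwd r U i [j] = U i j := by
  simp [fuseFwd]

lemma fuseRev_singleton (i j : ι) : fuseRev q U i [j] = U i j := by
  simp [fuseRev]

lemma Fused.of_fuseLeft (hnil : ∀ i, V i [] = 1)
    (hsupp : ∀ i (L J : List ι), i ∈ J → L ⊆ J → Supp J (V i L))
    (hpres : ∀ i L, (i :: L).Nodup → Pres (q • wt [i] + p • wt L) (V i L))
    (hpres_right : ∀ i L, (i :: L).Nodup → Pres (r • wt L) (V i L)) :
    Fused p q r (fuseLeft q V) := by
  have hs : ∀ {M L J : List ι}, M ⊆ J → L ⊆ J → Supp J (fuseLeft q V M L) := by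
    intro M L J hM hL
    induction M with
    | nil => exact Supp.one
    | cons i M ih =>
      rw [List.cons_subset] at hM
      exact (hsupp i L J hM.1 hL).mul ((ih hM.2).sh q (by simpa using hM.1))
  refine ⟨fun L => rfl, fun M => ?_, fun i M L => ?_, hs, fun {M L} hd => ?_, fun {M L} hd => ?_⟩
  · induction M with
    | nil => rfl
    | cons i M ih => simp [fuseLeft, ih, hnil]
  · rw [fuseLeft_singleton, fuseLeft]
  · induction M with
    | nil => exact Pres.one
    | cons i M ih =>
      rw [wt_cons, smul_add]
      refine Pres.mul ?_ (Pres.sh ?_)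
      · rw [add_right_comm]
        exact (hpres i L (by grind)).add
          ((hsupp i L (i :: L) (by simp) (by simp)).pres q (by grind))
      · rw [add_assoc]
        exact ((hs (J := M ++ L) (by simp) (by simp)).pres q (by grind)).add (ih (by grind))
  · induction M with
    | nil => exact Pres.one
    | cons i M ih =>
      exact (hpres_right i L (by grind)).mul (ih (by grind)).sh

section Rev

variable (hsupp : ∀ (i j : ι) (J : List ι), i ∈ J → j ∈ J → Supp J (U i j))
  (hpres : ∀ i j, i ≠ j → Pres (q • wt [i] + q • wt [j]) (U i j))
include hsupp hpres

lemma Fused.rev : Fused q q 0 (fuseLeft q (fuseRev q U)) := by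
  have hs : ∀ i (L J : List ι), i ∈ J → L ⊆ J → Supp J (fuseRev q U i L) := by
    intro i L J hi hL
    induction L with
    | nil => exact Supp.one
    | cons j L ih =>
      rw [List.cons_subset] at hL
      exact ((ih hL.2).sh q (by simpa using hL.1)).mul (hsupp i j J hi hL.1)
  refine Fused.of_fuseLeft (fun i => rfl) hs (fun i L hd => ?_) fun i L _ => ?_
  · induction L with
    | nil => exact Pres.one
    | cons j L ih =>
      rw [wt_cons j L, smul_add]
      refine Pres.mul (Pres.sh ?_) ?_
      · rw [add_left_comm]
        exact ((hs i L (i :: L) (by simp) (by simp)).pres q (by grind)).add (ih (by grind))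
      · rw [← add_assoc]
        exact (hpres i j (by grind)).add
          ((hsupp i j [i, j] (by simp) (by simp)).pres q (by grind))
  · rw [zero_smul]
    exact Pres.zero

lemma fuseLeft_rev_cons_right {M L : List ι} {j : ι} (hd : (M ++ j :: L).Nodup) :
    fuseLeft q (fuseRev q U) M (j :: L) =
      sh (q • wt [j]) (fuseLeft q (fuseRev q U) M L) * fuseLeft q (fuseRev q U) M [j] := by
  have hF := Fused.rev hsupp hpres
  induction M with
  | nil => simp [fuseLeft]
  | cons i M ih =>
    have hc := hF.commute_left hF (M := M) (N := L) (K := [i]) (L := [j]) (by grind)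
      (hF.pres (by grind))
    rw [← sh_sh, fuseLeft_singleton, fuseRev_singleton] at hc
    have hV := hF.pres_off (M := [i]) (N := [j]) (L := L) q (by grind)
    rw [fuseLeft_singleton] at hV
    rw [fuseLeft, ih (by grind), fuseRev, fuseLeft, fuseLeft, fuseRev_singleton, sh_mul hV,
      sh_mul (hF.pres_off q (by grind)).sh, sh_comm (φ := q • wt [j]) (ψ := q • wt [i])]
    simp only [mul_assoc]
    rw [← mul_assoc (U i j), ← hc, mul_assoc]

/-- The fused dynamical Yang–Baxter equation for a single family. -/
theorem YBE.rev (h : ∀ i j k, i ≠ j → i ≠ k → j ≠ k →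
      sh (q • wt [k]) (U i j) * U i k * sh (q • wt [i]) (U j k) =
        U j k * sh (q • wt [j]) (U i k) * U i j)
    {M N L : List ι} (hd : (M ++ N ++ L).Nodup) :
    YBE q q 0 (fuseLeft q (fuseRev q U)) (fuseLeft q (fuseRev q U)) M N L := by
  have hF := Fused.rev hsupp hpres
  refine YBE.of_singleton hF hF (fun i j N hd => fuseLeft_rev_cons_right hsupp hpres hd)
    (fun i j L hd => ?_) M N L hd
  induction L with
  | nil => simp [YBE, hF.nil_right]
  | cons k L ih =>
    refine YBE.cons_right_rev hF hF (fuseLeft_rev_cons_right hsupp hpres (by grind))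
      (fuseLeft_rev_cons_right hsupp hpres (by grind)) hd ?_ (ih (by grind))
    simpa [YBE, fuseLeft_singleton, fuseRev_singleton] using
      h i j k (by grind) (by grind) (by grind)

end Rev

section Fwd

variable (hsupp : ∀ (i j : ι) (J : List ι), i ∈ J → j ∈ J → Supp J (U i j))
  (hpres : ∀ i j, Pres (q • wt [i]) (U i j)) (hpres_right : ∀ i j, Pres (r • wt [j]) (U i j))
include hsupp hpres hpres_right

lemma Fused.fwd : Fused 0 q r (fuseLeft q (fuseFwd r U)) := by
  have hs : ∀ i (L J : List ι), i ∈ J → L ⊆ J → Supp J (fuseFwd r U i L) := by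
    intro i L J hi hL
    induction L with
    | nil => exact Supp.one
    | cons j L ih =>
      rw [List.cons_subset] at hL
      exact (hsupp i j J hi hL.1).mul ((ih hL.2).sh r (by simpa using hL.1))
  refine Fused.of_fuseLeft (fun i => rfl) hs (fun i L hd => ?_) fun i L hd => ?_
  · rw [zero_smul, add_zero]
    induction L with
    | nil => exact Pres.one
    | cons j L ih => exact (hpres i j).mul (ih (by grind)).sh
  · induction L with
    | nil => exact Pres.one
    | cons j L ih =>
      rw [wt_cons, smul_add]
      exact ((hpres_right i j).add
          ((hsupp i j [i, j] (by simp) (by simp)).pres r (by grind))).mul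
        (((hs i L (i :: L) (by simp) (by simp)).pres r (by grind)).add (ih (by grind))).sh

lemma fuseLeft_fwd_cons_right {M L : List ι} {j : ι} (hd : (M ++ j :: L).Nodup) :
    fuseLeft q (fuseFwd r U) M (j :: L) =
      fuseLeft q (fuseFwd r U) M [j] * sh (r • wt [j]) (fuseLeft q (fuseFwd r U) M L) := by
  have hF := Fused.fwd hsupp hpres hpres_right
  induction M with
  | nil => simp [fuseLeft]
  | cons i M ih =>
    have hq : Pres (q • wt [i]) (fuseLeft q (fuseFwd r U) [i] L) := by
      simpa using hF.pres (M := [i]) (L := L) (by grind)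
    have hc := hF.commute hF (M := [i]) (N := L) (K := M) (L := [j]) (by grind) hq
      (hF.pres_right (by grind))
    have hV := hF.pres_off (M := [i]) (N := [j]) (L := L) r (by grind)
    rw [fuseLeft_singleton] at hV hc
    rw [fuseLeft, ih (by grind), fuseFwd, fuseLeft, fuseLeft, fuseFwd_singleton, sh_mul hV,
      sh_mul (hF.pres_off q (by grind)), sh_comm (φ := r • wt [j]) (ψ := q • wt [i])]
    simp only [mul_assoc]
    rw [← mul_assoc (sh _ _), hc, mul_assoc]

/-- The fused exchange relations between two families. -/
theorem YBE.fwd {X : List ι → List ι → Lam n → Tens ι n ℂ} (hX : Fused q q 0 X)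
    (hXr : ∀ i j N, (i :: j :: N).Nodup → X [i] (j :: N) = sh (q • wt [j]) (X [i] N) * X [i] [j])
    (h : ∀ i j k, i ≠ j → i ≠ k → j ≠ k →
      X [i] [j] * U i k * sh (q • wt [i]) (U j k) =
        U j k * sh (q • wt [j]) (U i k) * sh (r • wt [k]) (X [i] [j]))
    {M N L : List ι} (hd : (M ++ N ++ L).Nodup) :
    YBE 0 q r X (fuseLeft q (fuseFwd r U)) M N L := by
  have hF := Fused.fwd hsupp hpres hpres_right
  refine YBE.of_singleton hX hF hXr (fun i j L hd => ?_) M N L hd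
  induction L with
  | nil => simp [YBE, hF.nil_right]
  | cons k L ih =>
    refine YBE.cons_right_fwd hX hF (fuseLeft_fwd_cons_right hsupp hpres hpres_right (by grind))
      (fuseLeft_fwd_cons_right hsupp hpres hpres_right (by grind)) hd ?_ (ih (by grind))
    simpa [YBE, fuseLeft_singleton, fuseFwd_singleton] using
      h i j k (by grind) (by grind) (by grind)

end Fwd

end Families

/-! ### The structure matrices at sites -/

/-- The two-site matrix-valued function `X` placed at the sites `i, j`. -/
noncomputable def site (X : DSM n) (i j : ι) : Lam n → Tens ι n ℂ := fun lam => emb2 (X lam) i j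

section Site

variable {X : DSM n}

lemma site_supp (X : DSM n) (i j : ι) (J : List ι) (hi : i ∈ J) (hj : j ∈ J) :
    Supp J (site X i j) := Supp.emb2 X hi hj

lemma site_ne_zero {i j : ι} {lam : Lam n} {f g : ι → Fin n} (h : site X i j lam f g ≠ 0) :
    X lam (f i, f j) (g i, g j) ≠ 0 := fun hc => h (by simp [site, emb2, hc])

lemma eq_of_commute_diagonal {m : Type*} [Fintype m] [DecidableEq m] {x : Matrix m m ℂ}
    {d : m → ℂ} (h : x * Matrix.diagonal d = Matrix.diagonal d * x) {a b : m}
    (hx : x a b ≠ 0) : d a = d b := by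
  have := congrFun (congrFun h a) b
  rw [Matrix.mul_diagonal, Matrix.diagonal_mul, mul_comm] at this
  exact (mul_right_cancel₀ hx this).symm

lemma WB.pres (h : WB X) (i j : ι) : Pres ((1 : ℂ) • wt [i]) (site X i j) := by
  intro lam f g hne
  funext c
  simpa [wt] using eq_of_commute_diagonal (h lam fun a => (ee a : Lam n) c) (site_ne_zero hne)

lemma WC.pres (h : WC X) (i j : ι) : Pres ((1 : ℂ) • wt [j]) (site X i j) := by
  intro lam f g hne
  funext c
  simpa [wt] using eq_of_commute_diagonal (h lam fun a => (ee a : Lam n) c) (site_ne_zero hne)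

lemma WD.pres (h : WD X) (i j : ι) :
    Pres ((1 : ℂ) • wt [i] + (1 : ℂ) • wt [j]) (site X i j) := by
  intro lam f g hne
  funext c
  simpa [wt] using eq_of_commute_diagonal (h lam fun a => (ee a : Lam n) c) (site_ne_zero hne)

lemma Pres.zero_smul_wt {Z : Lam n → Tens ι n ℂ} (M : List ι) : Pres ((0 : ℂ) • wt M) Z := by
  rw [zero_smul]
  exact Pres.zero

lemma site_lift {κ : Type*} [Fintype κ] [DecidableEq κ] {e : κ → ι} (he : Function.Injective e)
    (X : DSM n) (a b : κ) : lift e (site X a b) = site X (e a) (e b) := lift_emb2 he X a b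

lemma lift_sh_wt {κ : Type*} [Fintype κ] [DecidableEq κ] (e : κ → ι) (M : List κ)
    (x : Lam n → Tens κ n ℂ) : lift e (sh (wt M) x) = sh (wt (M.map e)) (lift e x) :=
  lift_sh (fun f => by simp [wt, Function.comp_def]) x

end Site

section Transfer

variable {A B C D : DSM n} {i j k : ι}

lemma injective_vec3 (hij : i ≠ j) (hik : i ≠ k) (hjk : j ≠ k) :
    Function.Injective ![i, j, k] := by
  intro a b
  fin_cases a <;> fin_cases b <;> simp [hij, hik, hjk, hij.symm, hik.symm, hjk.symm]

variable (hij : i ≠ j) (hik : i ≠ k) (hjk : j ≠ k)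
include hij hik hjk

lemma SDYB.AAA (h : SDYB A B C D) :
    site A i j * site A i k * site A j k = site A j k * site A i k * site A i j := by
  have he := injective_vec3 hij hik hjk
  have h' : site (ι := Fin 3) A 0 1 * site A 0 2 * site A 1 2 =
    site A 1 2 * site A 0 2 * site A 0 1 := funext h.1
  simpa [lift_mul he, site_lift he] using congrArg (lift ![i, j, k]) h'

lemma SDYB.DDD (h : SDYB A B C D) :
    sh (wt [k]) (site D i j) * site D i k * sh (wt [i]) (site D j k) =
      site D j k * sh (wt [j]) (site D i k) * site D i j := by
  have he := injective_vec3 hij hik hjk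
  have h' : dsh {2} (site (ι := Fin 3) D 0 1) * site D 0 2 * dsh {0} (site D 1 2) =
    site D 1 2 * dsh {1} (site D 0 2) * site D 0 1 := funext h.2.1
  simp only [dsh_singleton] at h'
  simpa [lift_mul he, site_lift he, lift_sh_wt] using congrArg (lift ![i, j, k]) h'

lemma SDYB.DBB (h : SDYB A B C D) :
    site D i j * site B i k * sh (wt [i]) (site B j k) =
      site B j k * sh (wt [j]) (site B i k) * site D i j := by
  have he := injective_vec3 hij hik hjk
  have h' : site (ι := Fin 3) D 0 1 * site B 0 2 * dsh {0} (site B 1 2) =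
    site B 1 2 * dsh {1} (site B 0 2) * site D 0 1 := funext h.2.2.1
  simp only [dsh_singleton] at h'
  simpa [lift_mul he, site_lift he, lift_sh_wt] using congrArg (lift ![i, j, k]) h'

lemma SDYB.ACC (h : SDYB A B C D) :
    site A i j * site C i k * site C j k =
      site C j k * site C i k * sh (wt [k]) (site A i j) := by
  have he := injective_vec3 hij hik hjk
  have h' : site (ι := Fin 3) A 0 1 * site C 0 2 * site C 1 2 =
    site C 1 2 * site C 0 2 * dsh {2} (site A 0 1) := funext h.2.2.2
  simp only [dsh_singleton] at h'
  simpa [lift_mul he, site_lift he, lift_sh_wt] using congrArg (lift ![i, j, k]) h'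

end Transfer

/-! ### Identification of the fused structure matrices -/

lemma fuseAd_eq (A : DSM n) (M N : List ι) :
    fuseAd A M N = fuseLeft 0 (fuseRev 0 (site A)) M N := by
  have hrow : ∀ i, (fun lam => (N.reverse.map fun j => emb2 (A lam) i j).prod) =
      fuseRev 0 (site A) i N := by
    intro i
    induction N with
    | nil => rfl
    | cons j N ih =>
      funext lam
      simp [fuseRev, ← ih, site]
  induction M with
  | nil => rfl
  | cons i M ih =>
    funext lam
    simp [fuseLeft, ← ih, ← hrow, fuseAd, fuse]

lemma fuseBd_eq (B : DSM n) (M N : List ι) :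
    fuseBd B M N = fuseLeft 1 (fuseFwd 0 (site B)) M N := by
  have hrow : ∀ i, (fun lam => (N.map fun j => emb2 (B lam) i j).prod) =
      fuseFwd 0 (site B) i N := by
    intro i
    induction N with
    | nil => rfl
    | cons j N ih =>
      funext lam
      simp [fuseFwd, ← ih, site]
  induction M with
  | nil => rfl
  | cons i M ih =>
    funext lam
    simp [fuseLeft, ← ih, ← hrow, fuseBd, dsh_singleton]

lemma fuseD1_append (D : DSM n) {i j : ι} {N : List ι} (h : (i :: j :: N).Nodup) :
    fuseD1 D i (N ++ [j]) = sh (wt [j]) (fuseD1 D i N) * site D i j := by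
  induction N with
  | nil =>
    have h1 : fuseD1 D i [] = 1 := rfl
    have h2 : fuseD1 D i [j] = dsh ([] : List ι).toFinset (site D i j) * fuseD1 D i [] := rfl
    rw [List.nil_append, h2, h1, dsh_toFinset List.nodup_nil]
    simp
  | cons k N ih =>
    have hrec : ∀ N : List ι, N.Nodup →
        fuseD1 D i (k :: N) = sh (wt N) (site D i k) * fuseD1 D i N := by
      intro N hN
      rw [← dsh_toFinset hN]
      rfl
    have hp : Pres (wt [j]) (site D i k) := by
      simpa using (site_supp D i k [i, k] (by simp) (by simp)).pres 1 (M := [j]) (by grind)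
    rw [List.cons_append, hrec _ (by grind), ih (by grind), hrec _ (by grind), sh_mul hp.sh,
      wt_append, sh_sh, mul_assoc, add_comm]

lemma fuseDd_eq (D : DSM n) {M N : List ι} (h : (M ++ N).Nodup) :
    fuseDd D M N = fuseLeft 1 (fuseRev 1 (site D)) M N := by
  have hrow : ∀ i, (i :: N).Nodup → fuseD1 D i N.reverse = fuseRev 1 (site D) i N := by
    intro i hi
    clear h
    induction N with
    | nil => rfl
    | cons j N ih =>
      rw [List.reverse_cons, fuseD1_append D (by simpa using hi), ih (by grind), fuseRev,
        one_smul]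
  induction M with
  | nil => rfl
  | cons i M ih =>
    rw [fuseLeft, ← ih (by grind), ← hrow i (by grind), one_smul, ← dsh_singleton]
    rfl

lemma fuseCd_eq {C : DSM n} (hC : WC C) {M N : List ι} (h : (M ++ N).Nodup) :
    fuseCd C M N = fuseLeft 0 (fuseFwd 1 (site C)) M N := by
  have hcol : ∀ j, (fun lam => (M.map fun i => emb2 (C lam) i j).prod) =
      fuseLeft 0 (fuseFwd 1 (site C)) M [j] := by
    intro j
    clear h
    induction M with
    | nil => rfl
    | cons i M ih =>
      funext lam
      simp [fuseLeft, ← ih, fuseFwd_singleton, site]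
  have hpres : ∀ i j : ι, Pres ((0 : ℂ) • wt [i]) (site C i j) := fun _ _ => Pres.zero_smul_wt _
  induction N with
  | nil =>
    rw [(Fused.fwd (site_supp C) hpres hC.pres).nil_right]
    rfl
  | cons j N ih =>
    rw [fuseLeft_fwd_cons_right (site_supp C) hpres hC.pres h, ← hcol, ← ih (by grind), one_smul,
      ← dsh_singleton]
    rfl

/-! ### Weights of the fused structure matrices -/

lemma Pres.apply_eq {X : Lam n → Tens ι n ℂ} {k : ι} (h : Pres ((1 : ℂ) • wt [k]) X)
    {lam : Lam n} {f g : ι → Fin n} (hne : X lam f g ≠ 0) : f k = g k := by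
  have := h lam f g hne
  by_contra hk
  have := congrFun this (f k)
  simp [wt, ee, hk] at this

lemma Fused.pres_left_site {r : ℂ} {Y : List ι → List ι → Lam n → Tens ι n ℂ}
    (hY : Fused 0 1 r Y) {M L : List ι} (hd : (M ++ L).Nodup) {k : ι} (hk : k ∈ M) : Pres ((1 : ℂ) • wt [k]) (Y M L) := by
  induction M with
  | nil => simp at hk
  | cons i M ih =>
    rw [hY.cons_left]
    rcases List.mem_cons.1 hk with rfl | hkM
    · exact Pres.mul (by simpa using hY.pres (M := [k]) (L := L) (by grind))
        (hY.pres_off 1 (by grind)).sh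
    · exact (hY.pres_off 1 (by grind)).mul (ih (by grind) hkM).sh

lemma fuseLeft_fwd_pres_right_site {q : ℂ} {U : ι → ι → Lam n → Tens ι n ℂ}
    (hsupp : ∀ (i j : ι) (J : List ι), i ∈ J → j ∈ J → Supp J (U i j))
    (hpres : ∀ i j, Pres (q • wt [i]) (U i j))
    (hpres_right : ∀ i j, Pres ((1 : ℂ) • wt [j]) (U i j))
    {M L : List ι} (hd : (M ++ L).Nodup) {k : ι} (hk : k ∈ L) :
    Pres ((1 : ℂ) • wt [k]) (fuseLeft q (fuseFwd 1 U) M L) := by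
  have hF := Fused.fwd hsupp hpres hpres_right
  induction L with
  | nil => simp at hk
  | cons j L ih =>
    rw [fuseLeft_fwd_cons_right hsupp hpres hpres_right hd]
    rcases List.mem_cons.1 hk with rfl | hkL
    · exact (hF.pres_right (by grind)).mul (hF.pres_off 1 (by grind)).sh
    · exact (hF.pres_off 1 (by grind)).mul (ih (by grind) hkL).sh

/-- fused semi-dynamical Yang–Baxter equations, and preservation
of the weight conditions under fusion. -/
theorem fused_semidynamical_YB {n : ℕ} (hn : 1 ≤ n)
    (A B C D : DSM n)
    (hwB : WB B) (hwC : WC C) (hwD : WD D) (hYB : SDYB A B C D)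
    {ι : Type} [Fintype ι] [DecidableEq ι] (M N L : List ι)
    (hM : M.Nodup) (hN : N.Nodup) (hL : L.Nodup)
    (hMN : M.Disjoint N) (hML : M.Disjoint L) (hNL : N.Disjoint L) :
    (∀ lam, fuseAd A M N lam * fuseAd A M L lam * fuseAd A N L lam
      = fuseAd A N L lam * fuseAd A M L lam * fuseAd A M N lam) ∧
    (∀ lam, fuseAd A M N lam * fuseCd C M L lam * fuseCd C N L lam
      = fuseCd C N L lam * fuseCd C M L lam * dsh L.toFinset (fuseAd A M N) lam) ∧
    (∀ lam, dsh L.toFinset (fuseDd D M N) lam * fuseDd D M L lam *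
        dsh M.toFinset (fuseDd D N L) lam
      = fuseDd D N L lam * dsh N.toFinset (fuseDd D M L) lam * fuseDd D M N lam) ∧
    (∀ lam, fuseDd D M N lam * fuseBd B M L lam * dsh M.toFinset (fuseBd B N L) lam
      = fuseBd B N L lam * dsh N.toFinset (fuseBd B M L) lam * fuseDd D M N lam) ∧
    (∀ lam f g, fuseBd B M N lam f g ≠ 0 → ∀ k ∈ M, f k = g k) ∧
    (∀ lam f g, fuseCd C M N lam f g ≠ 0 → ∀ k ∈ N, f k = g k) ∧
    (∀ lam f g, fuseDd D M N lam f g ≠ 0 →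
      shL (M.toFinset ∪ N.toFinset) f = shL (M.toFinset ∪ N.toFinset) g) := by
  have hMN' : (M ++ N).Nodup := hM.append hN hMN
  have hML' : (M ++ L).Nodup := hM.append hL hML
  have hNL' : (N ++ L).Nodup := hN.append hL hNL
  have hMNL : (M ++ N ++ L).Nodup :=
    hMN'.append hL (List.disjoint_append_left.2 ⟨hML, hNL⟩)
  have hA : ∀ i j : ι, i ≠ j → Pres ((0 : ℂ) • wt [i] + (0 : ℂ) • wt [j]) (site A i j) :=
    fun i j _ => (Pres.zero_smul_wt _).add (Pres.zero_smul_wt _)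
  have hB : ∀ i j : ι, Pres ((0 : ℂ) • wt [j]) (site B i j) := fun _ _ => Pres.zero_smul_wt _
  have hC : ∀ i j : ι, Pres ((0 : ℂ) • wt [i]) (site C i j) := fun _ _ => Pres.zero_smul_wt _
  have hD : ∀ i j : ι, i ≠ j → Pres ((1 : ℂ) • wt [i] + (1 : ℂ) • wt [j]) (site D i j) :=
    fun i j _ => hwD.pres i j
  have hFA := Fused.rev (site_supp A) hA
  have hFD := Fused.rev (site_supp D) hD
  simp only [dsh_toFinset hM, dsh_toFinset hN, dsh_toFinset hL, fuseAd_eq, fuseBd_eq,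
    fuseCd_eq hwC hMN', fuseCd_eq hwC hML', fuseCd_eq hwC hNL', fuseDd_eq D hMN',
    fuseDd_eq D hML', fuseDd_eq D hNL']
  refine ⟨?_, ?_, ?_, ?_, fun lam f g h k hk => ?_,
    fun lam f g h k hk => ?_, fun lam f g h => ?_⟩
  · have h := YBE.rev (site_supp A) hA
      (fun i j k hij hik hjk => by simpa using hYB.AAA hij hik hjk) hMNL
    simp only [YBE, zero_smul, sh_zero] at h
    exact congrFun h
  · have h := YBE.fwd (site_supp C) hC hwC.pres hFA
      (fun i j N hd => fuseLeft_rev_cons_right (site_supp A) hA hd)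
      (fun i j k hij hik hjk => by
        simpa [fuseLeft_singleton, fuseRev_singleton] using hYB.ACC hij hik hjk) hMNL
    simp only [YBE, zero_smul, one_smul, sh_zero] at h
    exact congrFun h
  · have h := YBE.rev (site_supp D) hD
      (fun i j k hij hik hjk => by simpa using hYB.DDD hij hik hjk) hMNL
    simp only [YBE, zero_smul, one_smul, sh_zero] at h
    exact congrFun h
  · have h := YBE.fwd (site_supp B) hwB.pres hB hFD
      (fun i j N hd => fuseLeft_rev_cons_right (site_supp D) hD hd)
      (fun i j k hij hik hjk => by
        simpa [fuseLeft_singleton, fuseRev_singleton] using hYB.DBB hij hik hjk) hMNL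
    simp only [YBE, zero_smul, one_smul, sh_zero] at h
    exact congrFun h
  · exact ((Fused.fwd (site_supp B) hwB.pres hB).pres_left_site hMN' hk).apply_eq h
  · exact (fuseLeft_fwd_pres_right_site (site_supp C) hC hwC.pres hMN' hk).apply_eq h
  · have := hFD.pres hMN' lam f g h
    simpa [← List.toFinset_append, shL_toFinset hMN', wt_append] using this

end QT
end

section
/- Let D(q) be a matrix-valued function of q ∈ ℂⁿ, indexed by multi-indices a ∈ {1,…,n}^k, with scalar entries, pointwise invertible, and satisfying the total zero-weight condition: the entry D_{ab}(q) vanishes unless Σ_{l=1}^{k} e_{a_l} = Σ_{l=1}^{k} e_{b_l}. Let X(q) be any matrix-valued function of the same size whose entries commute with the entries of D. Then the cyclicity identity Tr(D(q) X(q) D(q)⁻¹ e^𝒟) = Tr(X(q) e^𝒟) holds as an identity of difference operators acting on functions of q. -/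
open Matrix

namespace QT

variable {n : ℕ} {ι : Type*} [Fintype ι] [DecidableEq ι] {α : Type*}
variable {R : Type*} [Ring R] [Algebra ℂ R]

/-- `Σ_l e_{c_l}` : the shift associated with a multi-index. -/
noncomputable def msh {n k : ℕ} (c : Fin k → Fin n) : Fin n → ℂ :=
  ∑ l, Pi.single (c l) 1

/-- The inverse of an invertible matrix whose entries vanish off the fibres of `w`
has the same property. -/
theorem inv_apply_ne_zero_weight_eq {m W : Type*} [Fintype m] [DecidableEq m]
    {D : Matrix m m ℂ} (hD : IsUnit D) {w : m → W}
    (hw : ∀ a b, D a b ≠ 0 → w a = w b) {a b : m} (h : D⁻¹ a b ≠ 0) : w a = w b := by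
  classical
  by_contra hne
  let d : m → ℂ := fun c => if w c = w a then 1 else 0
  have hdet := (Matrix.isUnit_iff_isUnit_det D).1 hD
  have hcomm : D * Matrix.diagonal d = Matrix.diagonal d * D := by
    ext i j
    rw [Matrix.mul_diagonal, Matrix.diagonal_mul]
    by_cases hij : D i j = 0
    · simp [hij]
    · simp only [d, hw i j hij, mul_comm]
  have hinv : Matrix.diagonal d * D⁻¹ = D⁻¹ * Matrix.diagonal d := by
    calc Matrix.diagonal d * D⁻¹ = D⁻¹ * (D * Matrix.diagonal d) * D⁻¹ := by
          rw [← Matrix.mul_assoc, Matrix.nonsing_inv_mul D hdet, Matrix.one_mul]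
      _ = D⁻¹ * Matrix.diagonal d := by
          rw [hcomm, ← Matrix.mul_assoc, Matrix.mul_assoc, Matrix.mul_nonsing_inv D hdet,
            Matrix.mul_one]
  have hab := congrFun (congrFun hinv a) b
  rw [Matrix.diagonal_mul, Matrix.mul_diagonal] at hab
  simp [d, Ne.symm hne, h] at hab

/-- The trace of a matrix over an algebra is invariant under conjugation by an invertible
matrix of scalars. -/
theorem trace_map_conj {m K A : Type*} [Fintype m] [DecidableEq m] [CommRing K] [Ring A]
    [Algebra K A] {D : Matrix m m K} (hD : IsUnit D) (Y : Matrix m m A) :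
    Matrix.trace (D.map (algebraMap K A) * Y * D⁻¹.map (algebraMap K A)) =
      Matrix.trace Y := by
  have hdet := (Matrix.isUnit_iff_isUnit_det D).1 hD
  have hinv : D⁻¹.map (algebraMap K A) * D.map (algebraMap K A) = 1 := by
    rw [← Matrix.map_mul, Matrix.nonsing_inv_mul D hdet,
      Matrix.map_one _ (map_zero _) (map_one _)]
  have hswap (Z : Matrix m m A) : Matrix.trace (D.map (algebraMap K A) * Z) =
      Matrix.trace (Z * D.map (algebraMap K A)) := by
    simp only [Matrix.trace, Matrix.diag_apply, Matrix.mul_apply, Matrix.map_apply]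
    rw [Finset.sum_comm]
    exact Finset.sum_congr rfl fun _ _ => Finset.sum_congr rfl fun _ _ =>
      Algebra.commutes _ _
  rw [Matrix.mul_assoc, hswap, Matrix.mul_assoc, hinv, Matrix.mul_one]

/-- cyclicity of a total zero-weight matrix `D` under the trace
with the shift operator: `Tr(D X D⁻¹ e^𝒟) = Tr(X e^𝒟)`, as difference
operators acting on an arbitrary function `F`. -/
theorem zero_weight_cyclicity {n k : ℕ} (hn : 1 ≤ n) (hk : 1 ≤ k)
    {α : Type*} [Ring α] [Algebra ℂ α]
    (D : (Fin n → ℂ) → Matrix (Fin k → Fin n) (Fin k → Fin n) ℂ)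
    (hinv : ∀ q, IsUnit (D q))
    (hzw : ∀ q a b, D q a b ≠ 0 → msh a = msh b)
    (X : (Fin n → ℂ) → Matrix (Fin k → Fin n) (Fin k → Fin n) α)
    (F : (Fin n → ℂ) → α) (q : Fin n → ℂ) :
    ∑ a, ((D q).map (algebraMap ℂ α) * X q * ((D q)⁻¹).map (algebraMap ℂ α)) a a *
        F (q + msh a)
      = ∑ a, X q a a * F (q + msh a) := by
  have hcomm : (D q)⁻¹.map (algebraMap ℂ α) * Matrix.diagonal (fun a => F (q + msh a)) =
      Matrix.diagonal (fun a => F (q + msh a)) * (D q)⁻¹.map (algebraMap ℂ α) := by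
    ext a b
    rw [Matrix.mul_diagonal, Matrix.diagonal_mul, Matrix.map_apply]
    by_cases h : (D q)⁻¹ a b = 0
    · simp [h]
    · rw [inv_apply_ne_zero_weight_eq (hinv q) (hzw q) h, Algebra.commutes]
  have htrace := trace_map_conj (hinv q) (X q * Matrix.diagonal (fun a => F (q + msh a)))
  rw [← Matrix.mul_assoc, Matrix.mul_assoc _ (Matrix.diagonal _), ← hcomm,
    ← Matrix.mul_assoc] at htrace
  simpa only [Matrix.trace, Matrix.diag_apply, Matrix.mul_diagonal] using htrace

end QT
end

section
/- Let {T_M} and {K_M} be families of functions ℂⁿ → End(V^{⊗M})⊗R indexed by ordered label sets, such that every matrix entry of every T_M(λ) commutes in R with every matrix entry of every K_M(μ). Assume for all disjoint ordered label sets M, N′: (i) the fused semi-dynamical exchange relation A_{MN̄′} T_M B_{MN′} T_{N′}(λ+h_M) = T_{N′} C_{MN′} T_M(λ+h_{N′}) D_{MN̄′}, and (ii) the fused dual semi-dynamical exchange relation (A_{MN̄′}⁻¹)^{t_M t_{N′}} K_M (B_{MN′}^{t_{N′}})⁻¹ K_{N′}(λ+h_M) = K_{N′} (C_{MN′}^{t_M})⁻¹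 K_M(λ+h_{N′}) (D_{MN̄′}⁻¹)^{t_M t_{N′}}, where the scalar matrices A_{MN̄′}, D_{MN̄′}, B_{MN′}^{t_{N′}}, C_{MN′}^{t_M} are pointwise invertible and A, B, C, D satisfy the weight conditions. Define the difference operator H_M, acting on R-valued functions F of λ ∈ ℂⁿ, by (H_M F)(λ) := Σ_{a,b ∈ {1,…,n}^M} (T_M(λ))_{ab} (K_M(λ))_{ab} F(λ + Σ_{i∈M} e_{b_i}); equivalently H_M = Tr_M(T_M e^{𝒟_M} (K_M^{SC})^{t_M}). Then these operators mutually commute: H_M ∘ H_{N′} = H_{N′} ∘ H_M for all disjoint ordered label sets M, N′. -/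
open Matrix

namespace QT

variable {n : ℕ} {ι : Type*} [Fintype ι] [DecidableEq ι] {α : Type*}
variable {R : Type*} [Ring R] [Algebra ℂ R]

/-- The quantum-trace difference operator
`H_M = Tr_M ( T_M e^{𝒟_M} (K_M^{SC})^{t_M} )`, acting on `R`-valued functions:
`(H_M F)(λ) = Σ_{a,b} (T_M(λ))_{ab} (K_M(λ))_{ab} F(λ + Σ_{i∈M} e_{b_i})`. -/
noncomputable def Ham {n : ℕ} {ι : Type} [Fintype ι] [DecidableEq ι]
    {R : Type*} [Ring R] [Algebra ℂ R]
    (T K : (M : List ι) → Lam n → Matrix (idx n M) (idx n M) R)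
    (M : List ι) : (Lam n → R) → (Lam n → R) := fun F lam =>
  ∑ a : idx n M, ∑ b : idx n M,
    T M lam a b * K M lam a b * F (lam + ∑ i, ee (b i))

/-! ### Matrices preserving a function of the index -/

section Preserves

variable {I J : Type*}

/-- `X` has no entries between indices on which `φ` takes different values. -/
def Preserves {α : Type*} [Zero α] (φ : I → J) (X : Matrix I I α) : Prop :=
  ∀ f g, φ f ≠ φ g → X f g = 0

theorem Preserves.one {α : Type*} [DecidableEq I] [Semiring α] (φ : I → J) :
    Preserves φ (1 : Matrix I I α) := by
  intro f g h
  exact Matrix.one_apply_ne fun e => h (by rw [e])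

theorem Preserves.mul {α : Type*} [Fintype I] [Semiring α] {φ : I → J} {X Y : Matrix I I α}
    (hX : Preserves φ X) (hY : Preserves φ Y) : Preserves φ (X * Y) := by
  intro f g h
  rw [Matrix.mul_apply]
  refine Finset.sum_eq_zero fun p _ => ?_
  by_cases hp : φ f = φ p
  · rw [hY p g (fun e => h (hp.trans e)), mul_zero]
  · rw [hX f p hp, zero_mul]

theorem Preserves.list_prod {α : Type*} [Fintype I] [DecidableEq I] [Semiring α] {φ : I → J}
    {L : List (Matrix I I α)}
    (h : ∀ X ∈ L, Preserves φ X) : Preserves φ L.prod := by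
  induction L with
  | nil => exact Preserves.one φ
  | cons X L ih =>
    rw [List.prod_cons]
    exact (h X (by simp)).mul (ih fun Y hY => h Y (by simp [hY]))

theorem Preserves.transpose {α : Type*} [Zero α] {φ : I → J} {X : Matrix I I α}
    (hX : Preserves φ X) : Preserves φ Xᵀ :=
  fun f g h => hX g f (Ne.symm h)

theorem Preserves.map_algebraMap {R : Type*} [Ring R] [Algebra ℂ R] {φ : I → J}
    {X : Matrix I I ℂ} (hX : Preserves φ X) : Preserves φ (X.map (algebraMap ℂ R)) := by
  intro f g h
  rw [Matrix.map_apply, hX f g h, map_zero]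

theorem Preserves.inv [Fintype I] [DecidableEq I] {φ : I → J} {X : Matrix I I ℂ} (hX : Preserves φ X) (hu : IsUnit X) :
    Preserves φ X⁻¹ := by
  classical
  intro f g h
  set P : Matrix I I ℂ := Matrix.diagonal fun p => if φ p = φ f then 1 else 0 with hP
  have hc : Commute P X := by
    ext p q
    rw [hP, Matrix.diagonal_mul, Matrix.mul_diagonal]
    by_cases hpq : φ p = φ q
    · rw [hpq, mul_comm]
    · rw [hX p q hpq, mul_zero, zero_mul]
  obtain ⟨u, rfl⟩ := hu
  have hc' : P * (u : Matrix I I ℂ)⁻¹ = (u : Matrix I I ℂ)⁻¹ * P := by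
    rw [← Matrix.coe_units_inv]
    exact hc.units_inv_right
  have := congrFun (congrFun hc' f) g
  rw [hP, Matrix.diagonal_mul, Matrix.mul_diagonal] at this
  simpa [Ne.symm h] using this

end Preserves

/-! ### The weighted entrywise pairing -/

section Pairing

variable {I J J' : Type*} [Fintype I] [DecidableEq I] {R : Type*} [Ring R] [Algebra ℂ R]

/-- The pairing `Σ_{f,g} P_{fg} Q_{fg} w_g`. -/
def pairing (P Q : Matrix I I R) (w : I → R) : R :=
  ∑ f, ∑ g, P f g * Q f g * w g

omit [DecidableEq I] in
theorem pairing_scalar_mul (a : Matrix I I ℂ) (P Q : Matrix I I R) (w : I → R) :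
    pairing (a.map (algebraMap ℂ R) * P) Q w
      = pairing P (aᵀ.map (algebraMap ℂ R) * Q) w := by
  simp only [pairing, Matrix.mul_apply, Matrix.map_apply, Matrix.transpose_apply,
    Finset.sum_mul, Finset.mul_sum]
  rw [Finset.sum_comm]
  conv_rhs => rw [Finset.sum_comm]
  refine Finset.sum_congr rfl fun g _ => ?_
  rw [Finset.sum_comm]
  refine Finset.sum_congr rfl fun p _ => Finset.sum_congr rfl fun f _ => ?_
  simp only [← Algebra.smul_def, smul_mul_assoc, mul_smul_comm]

omit [DecidableEq I] in
theorem pairing_mul_scalar (d : Matrix I I ℂ) (P Q : Matrix I I R) (w : I → R)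
    (hd : Preserves w d) :
    pairing (P * d.map (algebraMap ℂ R)) Q w
      = pairing P (Q * dᵀ.map (algebraMap ℂ R)) w := by
  simp only [pairing, Matrix.mul_apply, Matrix.map_apply, Matrix.transpose_apply,
    Finset.sum_mul, Finset.mul_sum]
  refine Finset.sum_congr rfl fun f _ => ?_
  rw [Finset.sum_comm]
  refine Finset.sum_congr rfl fun p _ => Finset.sum_congr rfl fun g _ => ?_
  by_cases h : w p = w g
  · rw [h]
    simp only [← Algebra.commutes (d p g), ← Algebra.smul_def, smul_mul_assoc, mul_smul_comm]
  · rw [hd p g h]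
    simp

/-- Conjugating the two arguments by contragredient scalar matrices preserves the pairing. -/
theorem pairing_eq_of_intertwined {a d : Matrix I I ℂ} (ha : IsUnit a) (hd : IsUnit d)
    {P P' Q Q' : Matrix I I R} {w : I → R} (hw : Preserves w d)
    (hP : a.map (algebraMap ℂ R) * P = P' * d.map (algebraMap ℂ R))
    (hQ : (a⁻¹)ᵀ.map (algebraMap ℂ R) * Q = Q' * (d⁻¹)ᵀ.map (algebraMap ℂ R)) :
    pairing P Q w = pairing P' Q' w := by
  have ha' : a⁻¹ * a = 1 := Matrix.nonsing_inv_mul a ((Matrix.isUnit_iff_isUnit_det a).1 ha)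
  have hd' : d * d⁻¹ = 1 := Matrix.mul_nonsing_inv d ((Matrix.isUnit_iff_isUnit_det d).1 hd)
  have h1 : P = (a⁻¹).map (algebraMap ℂ R) * (P' * d.map (algebraMap ℂ R)) := by
    rw [← hP, ← Matrix.mul_assoc, ← Matrix.map_mul, ha',
      Matrix.map_one _ (map_zero _) (map_one _), Matrix.one_mul]
  rw [h1, pairing_scalar_mul, hQ, pairing_mul_scalar _ _ _ _ hw, Matrix.mul_assoc,
    ← Matrix.map_mul, ← Matrix.transpose_mul, hd', Matrix.transpose_one,
    Matrix.map_one _ (map_zero _) (map_one _), Matrix.mul_one]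

/-- If `E, E'` preserve `φ` and `G, G'` preserve `ψ`, where `(φ, ψ)` separates indices, then
the pairing of `E b G` with `E' (bᵀ)⁻¹ G'` does not depend on the scalar matrix `b`. -/
theorem pairing_sandwich {φ : I → J} {ψ : I → J'}
    (hsep : ∀ p q, φ p = φ q → ψ p = ψ q → p = q)
    {E E' G G' : Matrix I I R} {b : Matrix I I ℂ} (w : I → R)
    (hb : IsUnit bᵀ) (hbψ : Preserves ψ b)
    (hE : Preserves φ E) (hE' : Preserves φ E') (hG : Preserves ψ G) (hG' : Preserves ψ G')
    (hcomm : ∀ q g f p, Commute (G q g) (E' f p))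
    (hcol : ∀ p q, ψ p = ψ q → ∑ f, E f p * E' f p = ∑ f, E f q * E' f q) :
    pairing (E * b.map (algebraMap ℂ R) * G) (E' * (bᵀ)⁻¹.map (algebraMap ℂ R) * G') w
      = ∑ q, (∑ f, E f q * E' f q) * ∑ g, G q g * G' q g * w g := by
  set b' := (bᵀ)⁻¹ with hb'
  have hbb' : bᵀ * b' = 1 :=
    Matrix.mul_nonsing_inv _ ((Matrix.isUnit_iff_isUnit_det _).1 hb)
  have hb'ψ : Preserves ψ b' := hbψ.transpose.inv hb
  set G₁ := b.map (algebraMap ℂ R) * G with hG₁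
  set G₁' := b'.map (algebraMap ℂ R) * G' with hG₁'
  have pG₁ : Preserves ψ G₁ := hbψ.map_algebraMap.mul hG
  have pG₁' : Preserves ψ G₁' := hb'ψ.map_algebraMap.mul hG'
  have hc₁ : ∀ q g f p, Commute (G₁ q g) (E' f p) := by
    intro q g f p
    rw [hG₁, Matrix.mul_apply]
    refine Commute.sum_left _ _ _ fun r _ => Commute.mul_left ?_ (hcomm _ _ _ _)
    exact Algebra.commutes _ _
  have diag : ∀ f g, (E * G₁) f g * (E' * G₁') f g
      = ∑ p, E f p * E' f p * (G₁ p g * G₁' p g) := by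
    intro f g
    rw [Matrix.mul_apply, Matrix.mul_apply, Finset.sum_mul_sum]
    refine Finset.sum_congr rfl fun p _ => ?_
    rw [Finset.sum_eq_single p]
    · rw [mul_assoc, ← mul_assoc (G₁ p g), (hc₁ p g f p).eq]
      simp only [mul_assoc]
    · intro p' _ hne
      by_cases h1 : φ f = φ p
      · by_cases h2 : φ f = φ p'
        · by_cases h3 : ψ p = ψ g
          · rw [pG₁' p' g (fun h4 => hne (hsep _ _ (h2.symm.trans h1) (h4.trans h3.symm)))]
            simp
          · rw [pG₁ p g h3]; simp
        · rw [hE' f p' h2]; simp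
      · rw [hE f p h1]; simp
    · simp
  have step : ∀ g, ∑ p, (∑ f, E f p * E' f p) * (G₁ p g * G₁' p g)
      = ∑ q, (∑ f, E f q * E' f q) * (G q g * G' q g) := by
    intro g
    have e1 : ∀ p, (∑ f, E f p * E' f p) * (G₁ p g * G₁' p g)
        = ∑ q, ∑ q', (b p q * b' p q') • ((∑ f, E f q * E' f q) * (G q g * G' q' g)) := by
      intro p
      rw [hG₁, hG₁', Matrix.mul_apply, Matrix.mul_apply, Finset.sum_mul_sum, Finset.mul_sum]
      refine Finset.sum_congr rfl fun q _ => ?_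
      rw [Finset.mul_sum]
      refine Finset.sum_congr rfl fun q' _ => ?_
      by_cases h : ψ p = ψ q
      · rw [hcol p q h]
        simp only [Matrix.map_apply, ← Algebra.smul_def, smul_mul_assoc, mul_smul_comm, smul_smul]
        rw [mul_comm]
      · simp [hbψ p q h]
    simp only [e1]
    rw [Finset.sum_comm]
    refine Finset.sum_congr rfl fun q _ => ?_
    rw [Finset.sum_comm]
    have e2 : ∀ q', ∑ p, b p q * b' p q' = (1 : Matrix I I ℂ) q q' := by
      intro q'
      rw [← hbb', Matrix.mul_apply]
      rfl
    simp only [← Finset.sum_smul, e2]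
    rw [Finset.sum_eq_single q]
    · simp
    · intro q' _ hne
      rw [Matrix.one_apply_ne hne.symm, zero_smul]
    · simp
  rw [Matrix.mul_assoc, Matrix.mul_assoc]
  unfold pairing
  rw [Finset.sum_comm]
  simp only [← hG₁, ← hG₁', diag]
  have e3 : ∀ g, ∑ f, (∑ p, E f p * E' f p * (G₁ p g * G₁' p g)) * w g
      = ∑ q, (∑ f, E f q * E' f q) * (G q g * G' q g * w g) := by
    intro g
    rw [← Finset.sum_mul, Finset.sum_comm]
    simp only [← Finset.sum_mul]
    rw [step g, Finset.sum_mul]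
    simp only [mul_assoc]
  simp only [e3]
  rw [Finset.sum_comm]
  simp only [Finset.mul_sum]

end Pairing

/-! ### Support and weight of the fused structure matrices -/

/-- The restriction of a multi-index to the factors outside `S`. -/
def offIdx (S : Finset ι) (f : ι → Fin n) : {k // k ∉ S} → Fin n := fun k => f k

omit [Fintype ι] [DecidableEq ι] in
theorem offIdx_eq_iff {S : Finset ι} {f g : ι → Fin n} :
    offIdx S f = offIdx S g ↔ ∀ k, k ∉ S → f k = g k :=
  ⟨fun h k hk => congrFun h ⟨k, hk⟩, fun h => funext fun k => h k.1 k.2⟩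

theorem ptrans_eq_transpose [Zero α] {S : Finset ι} {X : Tens ι n α}
    (hX : Preserves (offIdx S) X) : ptrans S X = Xᵀ := by
  ext f g
  rw [ptrans, Matrix.of_apply, Matrix.transpose_apply]
  by_cases h : offIdx S f = offIdx S g
  · rw [offIdx_eq_iff] at h
    congr 1 <;> funext k <;> by_cases hk : k ∈ S <;> simp [hk, h k]
  · rw [hX g f (Ne.symm h)]
    refine hX _ _ fun e => h ?_
    rw [offIdx_eq_iff] at e ⊢
    intro k hk
    simpa [hk] using e k hk

omit [Fintype ι] in
theorem ptrans_ptrans (S S' : Finset ι) (h : Disjoint S S') (X : Tens ι n α) :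
    ptrans S' (ptrans S X) = ptrans (S ∪ S') X := by
  ext f g
  simp only [ptrans, Matrix.of_apply]
  congr 1 <;> funext k <;> by_cases hk : k ∈ S <;> by_cases hk' : k ∈ S' <;> simp [hk, hk']
  all_goals exact absurd hk' (Finset.disjoint_left.1 h hk)

omit [Fintype ι] [DecidableEq ι] in
theorem Preserves.dsh [Zero α] {J : Type*} {φ : (ι → Fin n) → J} {X : Lam n → Tens ι n α}
    (hX : ∀ mu, Preserves φ (X mu)) (S : Finset ι) (lam : Lam n) :
    Preserves φ (dsh S X lam) :=
  fun f g h => hX _ f g h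

theorem preserves_emb2 {X : M2 n ℂ} {i j : ι} {S : Finset ι} (hi : i ∈ S) (hj : j ∈ S) :
    Preserves (offIdx S) (emb2 X i j) := by
  intro f g h
  rw [emb2, Matrix.of_apply, if_neg]
  intro e
  refine h (offIdx_eq_iff.2 fun k hk => e k ?_ ?_)
  · rintro rfl; exact hk hi
  · rintro rfl; exact hk hj

theorem eq_zero_of_diagonal_comm {K : Type*} [Fintype K] [DecidableEq K] {X : Matrix K K ℂ}
    {d : K → ℂ} (h : X * Matrix.diagonal d = Matrix.diagonal d * X) {p q : K}
    (hne : d p ≠ d q) : X p q = 0 := by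
  have := congrFun (congrFun h p) q
  rw [Matrix.mul_diagonal, Matrix.diagonal_mul, mul_comm, ← sub_eq_zero, ← sub_mul] at this
  exact (mul_eq_zero.1 this).resolve_left (sub_ne_zero.2 hne.symm)

theorem WB.preserves_emb2 {B : DSM n} (hB : WB B) (lam : Lam n) (i : ι) {j : ι}
    {S : Finset ι} (hj : j ∈ S) : Preserves (offIdx S) (emb2 (B lam) i j) := by
  intro f g h
  rw [emb2, Matrix.of_apply]
  split_ifs with e
  · refine eq_zero_of_diagonal_comm (hB lam (Pi.single (f i) 1)) ?_
    have hfg : f i ≠ g i := by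
      intro hi
      refine h (offIdx_eq_iff.2 fun k hk => ?_)
      by_cases hki : k = i
      · rw [hki, hi]
      · exact e k hki (by rintro rfl; exact hk hj)
    simp [hfg.symm]
  · rfl

theorem WC.preserves_emb2 {C : DSM n} (hC : WC C) (lam : Lam n) {i : ι} (j : ι)
    {S : Finset ι} (hi : i ∈ S) : Preserves (offIdx S) (emb2 (C lam) i j) := by
  intro f g h
  rw [emb2, Matrix.of_apply]
  split_ifs with e
  · refine eq_zero_of_diagonal_comm (hC lam (Pi.single (f j) 1)) ?_
    have hfg : f j ≠ g j := by
      intro hj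
      refine h (offIdx_eq_iff.2 fun k hk => ?_)
      by_cases hkj : k = j
      · rw [hkj, hj]
      · exact e k (by rintro rfl; exact hk hi) hkj
    simp [hfg.symm]
  · rfl

theorem WD.preserves_emb2 {D : DSM n} (hD : WD D) (lam : Lam n) {i j : ι} (hij : i ≠ j)
    {S : Finset ι} (hi : i ∈ S) (hj : j ∈ S) : Preserves (shL (n := n) S) (emb2 (D lam) i j) := by
  intro f g h
  rw [emb2, Matrix.of_apply]
  split_ifs with e
  · have hne : ee (f i) + ee (f j) ≠ ee (g i) + ee (g j) := by
      intro hs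
      refine h ?_
      have hj' : j ∈ S.erase i := Finset.mem_erase.2 ⟨hij.symm, hj⟩
      rw [shL, shL, ← Finset.add_sum_erase S _ hi, ← Finset.add_sum_erase S _ hi,
        ← Finset.add_sum_erase _ _ hj', ← Finset.add_sum_erase _ _ hj', ← add_assoc,
        ← add_assoc, hs]
      congr 1
      refine Finset.sum_congr rfl fun k hk => ?_
      rw [Finset.mem_erase, Finset.mem_erase] at hk
      rw [e k hk.2.1 hk.1]
    obtain ⟨c, hc⟩ := Function.ne_iff.1 hne
    refine eq_zero_of_diagonal_comm (hD lam (Pi.single c 1)) ?_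
    simpa [ee, Pi.single_apply, eq_comm] using hc
  · rfl

theorem preserves_fuseAd (A : DSM n) (M N : List ι) (lam : Lam n) :
    Preserves (offIdx (M.toFinset ∪ N.toFinset)) (fuseAd A M N lam) := by
  refine Preserves.list_prod fun X hX => ?_
  obtain ⟨i, hi, rfl⟩ := List.mem_map.1 hX
  refine Preserves.list_prod fun Y hY => ?_
  obtain ⟨j, hj, rfl⟩ := List.mem_map.1 hY
  exact preserves_emb2 (by simp [hi]) (by simp [List.mem_reverse.1 hj])

theorem preserves_fuseBd {B : DSM n} (hB : WB B) (M N : List ι) (lam : Lam n) :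
    Preserves (offIdx N.toFinset) (fuseBd B M N lam) := by
  induction M generalizing lam with
  | nil => exact Preserves.one _
  | cons i M ih =>
    refine (Preserves.list_prod fun X hX => ?_).mul (Preserves.dsh ih _ _)
    obtain ⟨j, hj, rfl⟩ := List.mem_map.1 hX
    exact hB.preserves_emb2 lam i (by simp [hj])

theorem preserves_fuseCd {C : DSM n} (hC : WC C) (M N : List ι) (lam : Lam n) :
    Preserves (offIdx M.toFinset) (fuseCd C M N lam) := by
  induction N generalizing lam with
  | nil =>
    unfold fuseCd
    exact Preserves.one _
  | cons j N ih =>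
    unfold fuseCd
    refine (Preserves.list_prod fun X hX => ?_).mul (Preserves.dsh ih _ _)
    obtain ⟨i, hi, rfl⟩ := List.mem_map.1 hX
    exact hC.preserves_emb2 lam j (by simp [hi])

theorem preserves_fuseDd_of_forall {J : Type*} {φ : (ι → Fin n) → J} {D : DSM n} {M N : List ι}
    (h : ∀ i ∈ M, ∀ j ∈ N, ∀ mu, Preserves φ (emb2 (D mu) i j)) (lam : Lam n) :
    Preserves φ (fuseDd D M N lam) := by
  have h1 : ∀ (i : ι) (L : List ι), (∀ j ∈ L, ∀ mu, Preserves φ (emb2 (D mu) i j)) →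
      ∀ mu, Preserves φ (fuseD1 D i L mu) := by
    intro i L
    induction L with
    | nil => exact fun _ _ => Preserves.one _
    | cons j L ih =>
      intro hL mu
      exact (Preserves.dsh (hL j (by simp)) _ _).mul (ih (fun j' hj' => hL j' (by simp [hj'])) mu)
  induction M generalizing lam with
  | nil => exact Preserves.one _
  | cons i M ih =>
    exact (h1 i _ (fun j hj => h i (by simp) j (List.mem_reverse.1 hj)) lam).mul
      (Preserves.dsh (ih fun i' hi' => h i' (by simp [hi'])) _ _)

theorem preserves_embS [Zero α] (M : List ι) (X : Matrix (idx n M) (idx n M) α) :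
    Preserves (offIdx M.toFinset) (embS M X) := by
  intro f g h
  rw [embS, Matrix.of_apply, if_neg]
  exact fun e => h (offIdx_eq_iff.2 e)

/-! ### Sums over multi-indices -/

theorem sum_offIdx_eq {β : Type*} [AddCommMonoid β] (M : List ι) (p : ι → Fin n)
    (Φ : idx n M → β) :
    ∑ f : ι → Fin n, (if ∀ k, k ∉ M.toFinset → f k = p k then Φ (fun i => f i.1) else 0)
      = ∑ a, Φ a := by
  rw [← Finset.sum_filter]
  refine Finset.sum_bij' (fun f _ i => f i.1)
    (fun a _ k => if h : k ∈ M.toFinset then a ⟨k, h⟩ else p k) ?_ ?_ ?_ ?_ ?_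
  · simp
  · intro a _
    simp only [Finset.mem_filter, Finset.mem_univ, true_and]
    intro k hk
    simp [hk]
  · intro f hf
    simp only [Finset.mem_filter, Finset.mem_univ, true_and] at hf
    funext k
    by_cases hk : k ∈ M.toFinset
    · simp [hk]
    · simp [hk, hf k hk]
  · intro a _
    funext i
    simp [i.2]
  · simp

omit [Algebra ℂ R] in
theorem sum_embS_col (M : List ι) (X Y : Matrix (idx n M) (idx n M) R) (p : ι → Fin n) :
    ∑ f, embS M X f p * embS M Y f p
      = ∑ a, X a (fun i => p i.1) * Y a (fun i => p i.1) := by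
  rw [← sum_offIdx_eq M p]
  refine Finset.sum_congr rfl fun f _ => ?_
  simp only [embS, Matrix.of_apply]
  split_ifs <;> simp

omit [Fintype ι] in
theorem shL_eq_sum_idx (M : List ι) (f : ι → Fin n) :
    shL M.toFinset f = ∑ i : {x // x ∈ M.toFinset}, ee (f i.1) :=
  (Finset.sum_coe_sort M.toFinset fun k => ee (f k)).symm

omit [Fintype ι] [DecidableEq ι] in
theorem shL_congr {S : Finset ι} {f g : ι → Fin n} (h : ∀ k ∈ S, f k = g k) :
    shL S f = shL S g :=
  Finset.sum_congr rfl fun k hk => by rw [h k hk]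

omit [Algebra ℂ R] in
theorem sum_dsh_embS_row {S : Finset ι} {N : List ι} (hSN : Disjoint S N.toFinset)
    (X Y : Lam n → Matrix (idx n N) (idx n N) R) (F : Lam n → R) (lam : Lam n)
    (q : ι → Fin n) :
    ∑ g, dsh S (fun mu => embS N (X mu)) lam q g * dsh S (fun mu => embS N (Y mu)) lam q g *
        F (lam + (shL S g + shL N.toFinset g))
      = ∑ d, X (lam + shL S q) (fun i => q i.1) d * Y (lam + shL S q) (fun i => q i.1) d *
          F (lam + shL S q + ∑ i, ee (d i)) := by
  rw [← sum_offIdx_eq N q]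
  refine Finset.sum_congr rfl fun g _ => ?_
  simp only [dsh, embS, Matrix.of_apply]
  by_cases h : ∀ k, k ∉ N.toFinset → g k = q k
  · rw [if_pos h, if_pos fun k hk => (h k hk).symm, if_pos fun k hk => (h k hk).symm,
      shL_congr (f := g) (g := q) fun k hk => h k (Finset.disjoint_left.1 hSN hk),
      shL_eq_sum_idx N g, add_assoc lam]
  · rw [if_neg h, if_neg fun e => h fun k hk => (e k hk).symm]
    simp

theorem sum_comp_injective {κ β : Type*} [Fintype κ] [DecidableEq κ] [AddCommMonoid β]
    {j : κ → ι} (hj : Function.Injective j) (Φ : (κ → Fin n) → β) :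
    ∑ q : ι → Fin n, Φ (q ∘ j)
      = n ^ (Fintype.card ι - Fintype.card κ) • ∑ p, Φ p := by
  classical
  let e : (ι → Fin n) ≃ (κ → Fin n) × ({x // x ∉ Set.range j} → Fin n) :=
    (Equiv.piEquivPiSubtypeProd (fun x => x ∈ Set.range j) fun _ => Fin n).trans
      (Equiv.prodCongr ((Equiv.ofInjective j hj).symm.arrowCongr (Equiv.refl _))
        (Equiv.refl _))
  have he : ∀ q, (e q).1 = q ∘ j := fun q => rfl
  have hcard : Fintype.card ({x // x ∉ Set.range j} → Fin n)
      = n ^ (Fintype.card ι - Fintype.card κ) := by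
    rw [Fintype.card_fun, Fintype.card_fin, Fintype.card_subtype_compl]
    congr 2
    exact Set.card_range_of_injective hj
  simp only [← he]
  rw [Equiv.sum_comp e fun x => Φ x.1, Fintype.sum_prod_type, ← hcard, Finset.smul_sum]
  simp

theorem sum_restrict_restrict {β : Type*} [AddCommMonoid β] {M N : List ι}
    (hMN : Disjoint M.toFinset N.toFinset) (Φ : idx n M → idx n N → β) :
    ∑ q : ι → Fin n, Φ (fun i => q i.1) (fun i => q i.1)
      = n ^ (Fintype.card ι - (M.toFinset.card + N.toFinset.card)) • ∑ b, ∑ c, Φ b c := by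
  let j : {x // x ∈ M.toFinset} ⊕ {x // x ∈ N.toFinset} → ι := Sum.elim Subtype.val Subtype.val
  have hj : Function.Injective j := by
    refine Subtype.val_injective.sumElim Subtype.val_injective fun a b h => ?_
    exact Finset.disjoint_left.1 hMN a.2 (h ▸ b.2)
  have := sum_comp_injective hj fun p => Φ (p ∘ Sum.inl) (p ∘ Sum.inr)
  rw [Fintype.card_sum, Fintype.card_coe, Fintype.card_coe,
    ← Equiv.sum_comp (Equiv.sumArrowEquivProdArrow _ _ _).symm, Fintype.sum_prod_type] at this
  exact this

/-! ### Composites of the trace operators -/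

theorem pairing_eq_smul_Ham {n : ℕ} {ι : Type} [Fintype ι] [DecidableEq ι]
    {R : Type*} [Ring R] [Algebra ℂ R]
    (T K : (M : List ι) → Lam n → Matrix (idx n M) (idx n M) R)
    (hcomm : ∀ (M N : List ι) lam mu a b c d, Commute (T M lam a b) (K N mu c d))
    {M N : List ι} (hMN : Disjoint M.toFinset N.toFinset) {b : Tens ι n ℂ}
    (hb : Preserves (offIdx N.toFinset) b) (hu : IsUnit (ptrans N.toFinset b))
    (F : Lam n → R) (lam : Lam n) :
    pairing
        (embS M (T M lam) * b.map (algebraMap ℂ R) *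
          dsh M.toFinset (fun mu => embS N (T N mu)) lam)
        (embS M (K M lam) * ((ptrans N.toFinset b)⁻¹).map (algebraMap ℂ R) *
          dsh M.toFinset (fun mu => embS N (K N mu)) lam)
        (fun g => F (lam + (shL M.toFinset g + shL N.toFinset g)))
      = n ^ (Fintype.card ι - (M.toFinset.card + N.toFinset.card)) •
          Ham T K M (Ham T K N F) lam := by
  rw [ptrans_eq_transpose hb] at hu ⊢
  rw [pairing_sandwich (φ := offIdx M.toFinset) (ψ := offIdx N.toFinset) ?_ _ hu hb
    (preserves_embS _ _) (preserves_embS _ _)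
    (Preserves.dsh (fun _ => preserves_embS _ _) _ _)
    (Preserves.dsh (fun _ => preserves_embS _ _) _ _)]
  · simp only [sum_embS_col, sum_dsh_embS_row hMN]
    simp only [shL_eq_sum_idx M]
    rw [sum_restrict_restrict hMN fun b c => (∑ a, T M lam a b * K M lam a b) *
      ∑ d, T N (lam + ∑ i, ee (b i)) c d * K N (lam + ∑ i, ee (b i)) c d *
        F (lam + ∑ i, ee (b i) + ∑ i, ee (d i))]
    congr 1
    unfold Ham
    conv_rhs => rw [Finset.sum_comm]
    refine Finset.sum_congr rfl fun b _ => ?_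
    rw [← Finset.mul_sum, Finset.sum_mul]
  · intro q g f p
    simp only [dsh, embS, Matrix.of_apply]
    split_ifs
    · exact hcomm _ _ _ _ _ _ _ _
    all_goals simp
  · intro p q h
    rw [offIdx_eq_iff] at h
    have : (fun i : {x // x ∈ M.toFinset} => p i.1) = fun i => q i.1 :=
      funext fun i => h i.1 (Finset.disjoint_left.1 hMN i.2)
    rw [sum_embS_col, sum_embS_col, this]
  · intro p q h h'
    rw [offIdx_eq_iff] at h h'
    funext k
    by_cases hk : k ∈ M.toFinset
    · exact h' k (Finset.disjoint_left.1 hMN hk)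
    · exact h k hk

/-- commuting quantum traces for the semi-dynamical algebra. -/
theorem commuting_semidynamical_traces {n : ℕ} (hn : 1 ≤ n)
    {ι : Type} [Fintype ι] [DecidableEq ι]
    {R : Type*} [Ring R] [Algebra ℂ R]
    (A B C D : DSM n)
    (hwB : WB B) (hwC : WC C) (hwD : WD D)
    (T K : (M : List ι) → Lam n → Matrix (idx n M) (idx n M) R)
    (hcomm : ∀ (M N : List ι) lam mu a b c d, Commute (T M lam a b) (K N mu c d))
    (hfA : ∀ M N : List ι, OkPair M N → ∀ lam, IsUnit (fuseAd A M N lam))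
    (hfD : ∀ M N : List ι, OkPair M N → ∀ lam, IsUnit (fuseDd D M N lam))
    (hfB : ∀ M N : List ι, OkPair M N → ∀ lam,
      IsUnit (ptrans N.toFinset (fuseBd B M N lam)))
    (hfC : ∀ M N : List ι, OkPair M N → ∀ lam,
      IsUnit (ptrans M.toFinset (fuseCd C M N lam)))
    (hT : ∀ M N : List ι, OkPair M N → ∀ lam,
      (fuseAd A M N lam).map (algebraMap ℂ R) * embS M (T M lam) *
        (fuseBd B M N lam).map (algebraMap ℂ R) *
        dsh M.toFinset (fun mu => embS N (T N mu)) lam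
      = embS N (T N lam) * (fuseCd C M N lam).map (algebraMap ℂ R) *
        dsh N.toFinset (fun mu => embS M (T M mu)) lam *
        (fuseDd D M N lam).map (algebraMap ℂ R))
    (hK : ∀ M N : List ι, OkPair M N → ∀ lam,
      (ptrans N.toFinset (ptrans M.toFinset ((fuseAd A M N lam)⁻¹))).map (algebraMap ℂ R) *
        embS M (K M lam) *
        ((ptrans N.toFinset (fuseBd B M N lam))⁻¹).map (algebraMap ℂ R) *
        dsh M.toFinset (fun mu => embS N (K N mu)) lam
      = embS N (K N lam) *
        ((ptrans M.toFinset (fuseCd C M N lam))⁻¹).map (algebraMap ℂ R) *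
        dsh N.toFinset (fun mu => embS M (K M mu)) lam *
        (ptrans N.toFinset (ptrans M.toFinset ((fuseDd D M N lam)⁻¹))).map (algebraMap ℂ R)) :
    ∀ M N : List ι, OkPair M N →
      Ham T K M ∘ Ham T K N = Ham T K N ∘ Ham T K M := by
  intro M N hMN
  have hd : Disjoint M.toFinset N.toFinset := List.disjoint_toFinset_iff_disjoint.2 hMN.2.2
  have pA := preserves_fuseAd A M N
  have pD := preserves_fuseDd_of_forall (D := D) (M := M) (N := N)
    (φ := offIdx (M.toFinset ∪ N.toFinset)) fun i hi j hj mu =>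
      preserves_emb2 (by simp [hi]) (by simp [hj])
  have pD' := preserves_fuseDd_of_forall (D := D) (M := M) (N := N)
    (φ := shL (M.toFinset ∪ N.toFinset)) fun i hi j hj mu =>
      hwD.preserves_emb2 mu (by rintro rfl; exact hMN.2.2 hi hj) (by simp [hi]) (by simp [hj])
  funext F lam
  have h1 := pairing_eq_smul_Ham T K hcomm hd (preserves_fuseBd hwB M N lam)
    (hfB M N hMN lam) F lam
  have h2 := pairing_eq_smul_Ham T K hcomm hd.symm (preserves_fuseCd hwC M N lam)
    (hfC M N hMN lam) F lam
  have h3 := hK M N hMN lam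
  rw [ptrans_ptrans _ _ hd, ptrans_ptrans _ _ hd,
    ptrans_eq_transpose ((pA lam).inv (hfA M N hMN lam)),
    ptrans_eq_transpose ((pD lam).inv (hfD M N hMN lam))] at h3
  have h4 := hT M N hMN lam
  rw [Matrix.mul_assoc, Matrix.mul_assoc, ← Matrix.mul_assoc (embS M (T M lam))] at h4
  rw [Matrix.mul_assoc, Matrix.mul_assoc, ← Matrix.mul_assoc (embS M (K M lam))] at h3
  have h5 := pairing_eq_of_intertwined (hfA M N hMN lam) (hfD M N hMN lam)
    (w := fun g => F (lam + (shL M.toFinset g + shL N.toFinset g))) ?_ h4 h3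
  · rw [h1] at h5
    simp only [add_comm (shL N.toFinset _)] at h2
    rw [h2, add_comm N.toFinset.card] at h5
    set k := n ^ (Fintype.card ι - (M.toFinset.card + N.toFinset.card)) with hk
    have hk0 : (k : ℂ) ≠ 0 := by
      rw [hk]
      exact_mod_cast pow_ne_zero _ (by omega)
    rw [← Nat.cast_smul_eq_nsmul ℂ, ← Nat.cast_smul_eq_nsmul ℂ] at h5
    have h6 := congrArg (fun x => (k : ℂ)⁻¹ • x) h5
    simpa only [smul_smul, inv_mul_cancel₀ hk0, one_smul, Function.comp_apply] using h6
  · intro f g h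
    refine pD' lam f g fun e => h ?_
    simp only [shL, Finset.sum_union hd] at e
    simp only [shL, e]

end QT
end
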